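/- For every n ≥ 1 and κ > 0, the embedding ι^B_A : F^B_κ(A^n) → F^B_{4κ²}(rect(n+1,n+1)) satisfies: (i) Flip ∘ ι^B_A = ι^B_A ∘ Flip and Row^B_F ∘ ι^B_A = ι^B_A ∘ Row^B_F; (ii) the image of ι^B_A equals {π ∈ F^B_{4κ²}(rect(n+1,n+1)) : (Row^B_F)^{n+1}(π) = Flip(π)}. -/

import Mathlib

open scoped Classical

noncomputable section

/-- `P̂`: the poset `P` with a new minimum `0̂` and a new maximum `1̂` adjoined. -/
abbrev Phat (P : Type) := WithBot (WithTop P)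

instance {P : Type} [Fintype P] : Fintype (Phat P) :=
  inferInstanceAs (Fintype (Option (Option P)))

/-- The inclusion of `P` into `P̂`. -/
def emb {P : Type} (p : P) : Phat P := ((p : WithTop P) : WithBot (WithTop P))

/-- The new maximum `1̂` of `P̂`. -/
def topHat (P : Type) : Phat P := ((⊤ : WithTop P) : WithBot (WithTop P))

variable {P : Type} [Fintype P] [PartialOrder P]

/-- `∑_{y ⋖ x} π(y)`. -/
def covSumBelow (π : Phat P → ℝ) (x : Phat P) : ℝ :=
  ∑ y : Phat P, if y ⋖ x then π y else 0

/-- `∑_{x ⋖ y} 1/π(y)`. -/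
def covSumAboveInv (π : Phat P → ℝ) (x : Phat P) : ℝ :=
  ∑ y : Phat P, if x ⋖ y then (π y)⁻¹ else 0

/-- The birational order-filter rank toggle `𝐭_i`, in simultaneous form (it agrees with the
composition of the pairwise commuting birational order filter toggles `t_p` over `p ∈ P_i`,
since a toggle `t_p` only changes the value at `p` and only reads values at `p` and at
elements covering or covered by `p`, which have different ranks). -/
def rankToggleB (rk : P → ℕ) (i : ℕ) (π : Phat P → ℝ) : Phat P → ℝ :=
  fun x =>
    if ∃ p : P, rk p = i ∧ x = emb p then
      covSumBelow π x / (π x * covSumAboveInv π x)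
    else π x

/-- Apply a word of rank toggles; the head of the list is applied last, matching the
convention that in a product `𝐭_{i_1} 𝐭_{i_2} ⋯ 𝐭_{i_k}` the rightmost factor acts first. -/
def applyB (rk : P → ℕ) : List ℕ → (Phat P → ℝ) → Phat P → ℝ
  | [] => fun π => π
  | i :: w => fun π => rankToggleB rk i (applyB rk w π)

/-- The word `𝐭_0 𝐭_1 ⋯ 𝐭_r` for rowmotion. -/
def rowWordB (r : ℕ) : List ℕ := List.range (r + 1)

/-- The word `(𝐭_r)(𝐭_{r-1} 𝐭_r) ⋯ (𝐭_0 𝐭_1 ⋯ 𝐭_r)` for rowvacuation. -/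
def rvacWordB (r : ℕ) : List ℕ :=
  (List.range (r + 1)).foldr (fun k acc => (List.range (r + 1)).drop (r - k) ++ acc) []

/-- The word `(𝐭_0)(𝐭_1 𝐭_0) ⋯ (𝐭_r 𝐭_{r-1} ⋯ 𝐭_0)` for dual rowvacuation. -/
def drvacWordB (r : ℕ) : List ℕ :=
  (List.range (r + 1)).foldr (fun k acc => (List.range (k + 1)).reverse ++ acc) []

/-- Birational order filter rowmotion `Row^B_F = 𝐭_0 𝐭_1 ⋯ 𝐭_r`. -/
def RowB (rk : P → ℕ) (r : ℕ) : (Phat P → ℝ) → Phat P → ℝ := applyB rk (rowWordB r)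

/-- The inverse of birational order filter rowmotion, `(Row^B_F)⁻¹ = 𝐭_r ⋯ 𝐭_1 𝐭_0`
(each toggle is an involution, so the reversed word gives the inverse map). -/
def RowInvB (rk : P → ℕ) (r : ℕ) : (Phat P → ℝ) → Phat P → ℝ := applyB rk (rowWordB r).reverse

/-- Birational order filter rowvacuation `Rvac^B_F`. -/
def RvacB (rk : P → ℕ) (r : ℕ) : (Phat P → ℝ) → Phat P → ℝ := applyB rk (rvacWordB r)

/-- Birational order filter dual rowvacuation `DRvac^B_F`. -/
def DRvacB (rk : P → ℕ) (r : ℕ) : (Phat P → ℝ) → Phat P → ℝ := applyB rk (drvacWordB r)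

end

/-- The underlying set of the poset `Aⁿ`: pairs `(i,j)` with `1 ≤ i ≤ j ≤ n`,
representing the intervals `[i,j] ⊆ [n]`. -/
def AnP (n : ℕ) : Type := {p : ℕ × ℕ // 1 ≤ p.1 ∧ p.1 ≤ p.2 ∧ p.2 ≤ n}

/-- `Aⁿ` is ordered by containment of intervals. -/
instance (n : ℕ) : PartialOrder (AnP n) where
  le x y := y.val.1 ≤ x.val.1 ∧ x.val.2 ≤ y.val.2
  le_refl x := ⟨le_refl _, le_refl _⟩
  le_trans x y z h1 h2 := ⟨le_trans h2.1 h1.1, le_trans h1.2 h2.2⟩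
  le_antisymm x y h1 h2 :=
    Subtype.ext (Prod.ext_iff.mpr ⟨le_antisymm h2.1 h1.1, le_antisymm h1.2 h2.2⟩)

instance (n : ℕ) : Fintype (AnP n) :=
  Fintype.subtype
    ((Finset.Icc 1 n ×ˢ Finset.Icc 1 n).filter (fun p => 1 ≤ p.1 ∧ p.1 ≤ p.2 ∧ p.2 ≤ n))
    (by
      intro x
      simp only [Finset.mem_filter, Finset.mem_product, Finset.mem_Icc]
      omega)

/-- The rank function of `Aⁿ`: `rk [i,j] = j - i`; `Aⁿ` is graded of rank `n - 1`. -/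
def rkAn (n : ℕ) : AnP n → ℕ := fun p => p.val.2 - p.val.1
noncomputable section

/-- The underlying set of the rectangle poset `rect(a,b)`:
pairs `(i,j)` with `1 ≤ i ≤ a`, `1 ≤ j ≤ b`. -/
def RectP (a b : ℕ) : Type := {p : ℕ × ℕ // 1 ≤ p.1 ∧ p.1 ≤ a ∧ 1 ≤ p.2 ∧ p.2 ≤ b}

/-- `rect(a,b)` carries the componentwise order. -/
instance (a b : ℕ) : PartialOrder (RectP a b) where
  le x y := x.val.1 ≤ y.val.1 ∧ x.val.2 ≤ y.val.2
  le_refl x := ⟨le_refl _, le_refl _⟩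
  le_trans x y z h1 h2 := ⟨le_trans h1.1 h2.1, le_trans h1.2 h2.2⟩
  le_antisymm x y h1 h2 :=
    Subtype.ext (Prod.ext_iff.mpr ⟨le_antisymm h1.1 h2.1, le_antisymm h1.2 h2.2⟩)

instance (a b : ℕ) : Fintype (RectP a b) :=
  Fintype.subtype
    ((Finset.Icc 1 a ×ˢ Finset.Icc 1 b).filter (fun p => 1 ≤ p.1 ∧ p.1 ≤ a ∧ 1 ≤ p.2 ∧ p.2 ≤ b))
    (by
      intro x
      simp only [Finset.mem_filter, Finset.mem_product, Finset.mem_Icc]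
      omega)

/-- The rank function of `rect(a,b)`: `rk (i,j) = i + j - 2`;
`rect(a,b)` is graded of rank `a + b - 2`. -/
def rkRect (a b : ℕ) : RectP a b → ℕ := fun p => p.val.1 + p.val.2 - 2

/-- The poset automorphism `Flip` of `Aⁿ`, `[i,j] ↦ [n+1-j, n+1-i]`
(the reflection of `Aⁿ` across its vertical axis of symmetry). -/
def flipAn (n : ℕ) (p : AnP n) : AnP n :=
  ⟨(n + 1 - p.val.2, n + 1 - p.val.1), by
    have h := p.2
    show 1 ≤ n + 1 - p.val.2 ∧ n + 1 - p.val.2 ≤ n + 1 - p.val.1 ∧ n + 1 - p.val.1 ≤ n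
    omega⟩

/-- `Flip` acting on labelings of `Âⁿ`: `(Flip π)(p) = π(Flip p)`, fixing `0̂` and `1̂`. -/
def flipLabelAn (n : ℕ) (π : Phat (AnP n) → ℝ) : Phat (AnP n) → ℝ :=
  fun x => if h : ∃ q : AnP n, x = emb q then π (emb (flipAn n h.choose)) else π x

/-- The poset automorphism `Flip` of the square `rect(m,m)`: `(i,j) ↦ (j,i)`. -/
def flipRect (m : ℕ) (p : RectP m m) : RectP m m :=
  ⟨(p.val.2, p.val.1), ⟨p.2.2.2.1, p.2.2.2.2, p.2.1, p.2.2.1⟩⟩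

/-- `Flip` acting on labelings of the square with `0̂`, `1̂` adjoined:
`(Flip π)(p) = π(Flip p)`, fixing `0̂` and `1̂`. -/
def flipLabelRect (m : ℕ) (π : Phat (RectP m m) → ℝ) : Phat (RectP m m) → ℝ :=
  fun x => if h : ∃ q : RectP m m, x = emb q then π (emb (flipRect m h.choose)) else π x

/-- The value of the Grinberg–Roby embedding `ι^B_A` at an element `(i,j)` of
`rect(n+1,n+1)`: ranks `n+1,…,2n` (i.e. `i+j > n+2`) are filled with `4κ·π`, the middle
rank (`i+j = n+2`) with `2κ`, and ranks `0,…,n-1` (i.e. `i+j < n+2`) with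
`κ/(Rvac^B_F π)`, suitably re-indexed. -/
def iotaVal (n : ℕ) (κ : ℝ) (π : Phat (AnP n) → ℝ) (q : RectP (n + 1) (n + 1)) : ℝ :=
  if h : n + 2 < q.val.1 + q.val.2 then
    4 * κ * π (emb (⟨(n + 2 - q.val.1, q.val.2 - 1), by
      have hq := q.2
      show 1 ≤ n + 2 - q.val.1 ∧ n + 2 - q.val.1 ≤ q.val.2 - 1 ∧ q.val.2 - 1 ≤ n
      omega⟩ : AnP n))
  else if h2 : q.val.1 + q.val.2 = n + 2 then 2 * κ
  else
    κ / RvacB (rkAn n) (n - 1) π (emb (⟨(q.val.2, n + 1 - q.val.1), by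
      have hq := q.2
      show 1 ≤ q.val.2 ∧ q.val.2 ≤ n + 1 - q.val.1 ∧ n + 1 - q.val.1 ≤ n
      omega⟩ : AnP n))

/-- The Grinberg–Roby embedding `ι^B_A : F^B_κ(Aⁿ) → F^B_{4κ²}(rect(n+1,n+1))`. -/
def iotaAn (n : ℕ) (κ : ℝ) (π : Phat (AnP n) → ℝ) : Phat (RectP (n + 1) (n + 1)) → ℝ :=
  fun x =>
    if x = (⊥ : Phat (RectP (n + 1) (n + 1))) then 1
    else if x = topHat (RectP (n + 1) (n + 1)) then 4 * κ ^ 2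
    else if h : ∃ q : RectP (n + 1) (n + 1), x = emb q then iotaVal n κ π h.choose
    else 0
end

section Phat

variable {P : Type}

theorem emb_injective : Function.Injective (emb : P → Phat P) := fun _ _ h =>
  WithTop.coe_injective (WithBot.coe_injective h)

theorem emb_ne_bot (p : P) : emb p ≠ ⊥ := WithBot.coe_ne_bot

theorem emb_ne_topHat (p : P) : emb p ≠ topHat P := fun h =>
  WithTop.coe_ne_top (WithBot.coe_injective h)

theorem topHat_ne_bot : topHat P ≠ ⊥ := WithBot.coe_ne_bot

theorem phat_cases (x : Phat P) : x = ⊥ ∨ x = topHat P ∨ ∃ p, x = emb p := by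
  induction x using WithBot.recBotCoe with
  | bot => exact Or.inl rfl
  | coe y =>
    induction y using WithTop.recTopCoe with
    | top => exact Or.inr (Or.inl rfl)
    | coe p => exact Or.inr (Or.inr ⟨p, rfl⟩)

theorem phat_ext {π σ : Phat P → ℝ} (hbot : π ⊥ = σ ⊥) (htop : π (topHat P) = σ (topHat P))
    (h : ∀ p, π (emb p) = σ (emb p)) : π = σ := by
  funext x
  rcases phat_cases x with rfl | rfl | ⟨p, rfl⟩
  exacts [hbot, htop, h p]

theorem sum_phat [Fintype P] (F : Phat P → ℝ) :
    ∑ x, F x = F ⊥ + F (topHat P) + ∑ p, F (emb p) := by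
  have h (G : Option (Option P) → ℝ) :
      ∑ x, G x = G none + G (some none) + ∑ p, G (some (some p)) := by
    rw [Fintype.sum_option, Fintype.sum_option, ← add_assoc]
  exact h F

variable [PartialOrder P]

theorem emb_covBy_emb {p q : P} : emb p ⋖ emb q ↔ p ⋖ q := by
  rw [emb, emb, WithBot.coe_covBy_coe, WithTop.coe_covBy_coe]

theorem bot_covBy_emb {q : P} : (⊥ : Phat P) ⋖ emb q ↔ IsMin q := by
  rw [emb, WithBot.bot_covBy_coe]
  constructor
  · intro h y hy
    exact WithTop.coe_le_coe.1 (h (WithTop.coe_le_coe.2 hy))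
  · intro h y hy
    induction y using WithTop.recTopCoe with
    | top => exact le_top
    | coe y => exact WithTop.coe_le_coe.2 (h (WithTop.coe_le_coe.1 hy))

theorem emb_covBy_topHat {q : P} : emb q ⋖ topHat P ↔ IsMax q := by
  rw [emb, topHat, WithBot.coe_covBy_coe, WithTop.coe_covBy_top]

theorem not_covBy_phat_bot (x : Phat P) : ¬ x ⋖ ⊥ := fun h => not_lt_bot h.lt

theorem not_phat_topHat_covBy (x : Phat P) : ¬ topHat P ⋖ x := fun h =>
  not_top_lt (a := x) h.lt

variable [Fintype P]

theorem covSumBelow_emb (π : Phat P → ℝ) (q : P) :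
    covSumBelow π (emb q) =
      (∑ p, if p ⋖ q then π (emb p) else 0) + if IsMin q then π ⊥ else 0 := by
  rw [covSumBelow, sum_phat]
  simp only [emb_covBy_emb, bot_covBy_emb, not_phat_topHat_covBy, if_false, add_zero]
  rw [add_comm]

theorem covSumAboveInv_emb (π : Phat P → ℝ) (q : P) :
    covSumAboveInv π (emb q) =
      (∑ p, if q ⋖ p then (π (emb p))⁻¹ else 0) + if IsMax q then (π (topHat P))⁻¹ else 0 := by
  rw [covSumAboveInv, sum_phat]
  simp only [emb_covBy_emb, emb_covBy_topHat, not_covBy_phat_bot, if_false, zero_add]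
  rw [add_comm]

theorem covSumBelow_pos {π : Phat P → ℝ} (hπ : ∀ x, 0 < π x) (q : P) :
    0 < covSumBelow π (emb q) := by
  have hmin : ¬ IsMin (emb q) := fun h => emb_ne_bot q (h.eq_bot)
  obtain ⟨y, hy⟩ := exists_covBy_of_wellFoundedGT hmin
  refine Finset.sum_pos' (fun x _ => ?_) ⟨y, Finset.mem_univ y, ?_⟩
  · split_ifs
    exacts [(hπ x).le, le_rfl]
  · rw [if_pos hy]
    exact hπ y

theorem covSumAboveInv_pos {π : Phat P → ℝ} (hπ : ∀ x, 0 < π x) (q : P) :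
    0 < covSumAboveInv π (emb q) := by
  have hmax : ¬ IsMax (emb q) := fun h => emb_ne_topHat q (h.eq_of_le (b := topHat P) le_top)
  obtain ⟨y, hy⟩ := exists_covBy_of_wellFoundedLT hmax
  refine Finset.sum_pos' (fun x _ => ?_) ⟨y, Finset.mem_univ y, ?_⟩
  · split_ifs
    exacts [(inv_pos.2 (hπ x)).le, le_rfl]
  · rw [if_pos hy]
    exact inv_pos.2 (hπ y)

/-- Two labelings with equal values at `0̂` and at the elements covered by `q` have the same
sum below `q`. -/
theorem covSumBelow_congr {π σ : Phat P → ℝ} {q : P} (hbot : π ⊥ = σ ⊥)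
    (h : ∀ p, p ⋖ q → π (emb p) = σ (emb p)) :
    covSumBelow π (emb q) = covSumBelow σ (emb q) := by
  rw [covSumBelow_emb, covSumBelow_emb, hbot]
  congr 1
  refine Finset.sum_congr rfl fun p _ => ?_
  split_ifs with hp
  exacts [h p hp, rfl]

theorem covSumAboveInv_congr {π σ : Phat P → ℝ} {q : P} (htop : π (topHat P) = σ (topHat P))
    (h : ∀ p, q ⋖ p → π (emb p) = σ (emb p)) :
    covSumAboveInv π (emb q) = covSumAboveInv σ (emb q) := by
  rw [covSumAboveInv_emb, covSumAboveInv_emb, htop]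
  congr 1
  refine Finset.sum_congr rfl fun p _ => ?_
  split_ifs with hp
  exacts [by rw [h p hp], rfl]

/-- `IsRow π σ` is the system of equations characterizing `σ` as the birational rowmotion
image of `π`. -/
structure IsRow (π σ : Phat P → ℝ) : Prop where
  bot : σ ⊥ = π ⊥
  top : σ (topHat P) = π (topHat P)
  apply_emb : ∀ p, σ (emb p) = covSumBelow π (emb p) / (π (emb p) * covSumAboveInv σ (emb p))

end Phat

section Graded

variable {P : Type} [Fintype P] [PartialOrder P] {rk : P → ℕ} {r : ℕ}

theorem IsRow.unique (hcov : ∀ p q : P, p ⋖ q → rk q = rk p + 1) (hr : ∀ p, rk p ≤ r)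
    {π σ τ : Phat P → ℝ} (hσ : IsRow π σ) (hτ : IsRow π τ) : σ = τ := by
  have htop : σ (topHat P) = τ (topHat P) := by rw [hσ.top, hτ.top]
  refine phat_ext (by rw [hσ.bot, hτ.bot]) htop fun p => ?_
  induction hk : r - rk p using Nat.strong_induction_on generalizing p with
  | _ k ih =>
    rw [hσ.apply_emb, hτ.apply_emb, covSumAboveInv_congr htop fun q hq => ih (r - rk q) ?_ q rfl]
    have := hcov p q hq
    have := hr q
    omega

theorem rankToggleB_bot (i : ℕ) (π : Phat P → ℝ) : rankToggleB rk i π ⊥ = π ⊥ := by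
  rw [rankToggleB, if_neg]
  rintro ⟨p, -, h⟩
  exact emb_ne_bot p h.symm

theorem rankToggleB_topHat (i : ℕ) (π : Phat P → ℝ) :
    rankToggleB rk i π (topHat P) = π (topHat P) := by
  rw [rankToggleB, if_neg]
  rintro ⟨p, -, h⟩
  exact emb_ne_topHat p h.symm

theorem rankToggleB_emb (i : ℕ) (π : Phat P → ℝ) (p : P) :
    rankToggleB rk i π (emb p) = if rk p = i then
      covSumBelow π (emb p) / (π (emb p) * covSumAboveInv π (emb p)) else π (emb p) := by
  have : (∃ q : P, rk q = i ∧ emb p = emb q) ↔ rk p = i :=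
    ⟨fun ⟨q, hq, h⟩ => emb_injective h ▸ hq, fun h => ⟨p, h, rfl⟩⟩
  simp only [rankToggleB, this]

theorem applyB_cons (i : ℕ) (w : List ℕ) (π : Phat P → ℝ) :
    applyB rk (i :: w) π = rankToggleB rk i (applyB rk w π) := rfl

theorem applyB_bot (w : List ℕ) (π : Phat P → ℝ) : applyB rk w π ⊥ = π ⊥ := by
  induction w with
  | nil => rfl
  | cons i w ih => rw [applyB_cons, rankToggleB_bot, ih]

theorem applyB_topHat (w : List ℕ) (π : Phat P → ℝ) :
    applyB rk w π (topHat P) = π (topHat P) := by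
  induction w with
  | nil => rfl
  | cons i w ih => rw [applyB_cons, rankToggleB_topHat, ih]

theorem applyB_append (v w : List ℕ) (π : Phat P → ℝ) :
    applyB rk (v ++ w) π = applyB rk v (applyB rk w π) := by
  induction v with
  | nil => rfl
  | cons i v ih => rw [List.cons_append, applyB_cons, ih, applyB_cons]

/-- The word `𝐭_k ⋯ 𝐭_r` leaves the ranks below `k` unchanged and solves the rowmotion
equations on the ranks from `k` on. -/
theorem applyB_drop_range (hcov : ∀ p q : P, p ⋖ q → rk q = rk p + 1) (hr : ∀ p, rk p ≤ r)
    (π : Phat P → ℝ) {k : ℕ} (hk : k ≤ r + 1) (p : P) :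
    applyB rk ((List.range (r + 1)).drop k) π (emb p) = if rk p < k then π (emb p) else
      covSumBelow π (emb p) / (π (emb p) *
        covSumAboveInv (applyB rk ((List.range (r + 1)).drop k) π) (emb p)) := by
  induction hk using Nat.decreasingInduction generalizing p with
  | self =>
    rw [List.drop_of_length_le (by simp), if_pos (Nat.lt_succ_of_le (hr p))]
    rfl
  | of_succ k hk ih =>
    have hw : (List.range (r + 1)).drop k = k :: (List.range (r + 1)).drop (k + 1) := by
      rw [List.drop_eq_getElem_cons (by simpa using hk)]
      simp
    set τ := applyB rk ((List.range (r + 1)).drop (k + 1)) π with hτ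
    have happ : applyB rk ((List.range (r + 1)).drop k) π = rankToggleB rk k τ := by
      rw [hw, applyB_cons]
    have habove : k ≤ rk p → covSumAboveInv (rankToggleB rk k τ) (emb p) =
        covSumAboveInv τ (emb p) := fun hp =>
      covSumAboveInv_congr (rankToggleB_topHat _ _) fun q hq => by
        have := hcov p q hq
        rw [rankToggleB_emb, if_neg (by omega)]
    rw [happ, rankToggleB_emb]
    rcases lt_trichotomy (rk p) k with h | h | h
    · rw [if_neg h.ne, if_pos h, ih, if_pos (by omega)]
    · rw [if_pos h, if_neg (by omega), habove h.ge, ih, if_pos (by omega)]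
      congr 1
      refine covSumBelow_congr (applyB_bot _ _) fun q hq => ?_
      have := hcov q p hq
      rw [ih, if_pos (by omega)]
    · rw [if_neg (by omega), if_neg (by omega), habove h.le, ih, if_neg (by omega)]

theorem isRow_RowB (hcov : ∀ p q : P, p ⋖ q → rk q = rk p + 1) (hr : ∀ p, rk p ≤ r)
    (π : Phat P → ℝ) : IsRow π (RowB rk r π) where
  bot := applyB_bot _ _
  top := applyB_topHat _ _
  apply_emb p := applyB_drop_range hcov hr π (Nat.zero_le _) p

theorem IsRow.eq_RowB (hcov : ∀ p q : P, p ⋖ q → rk q = rk p + 1) (hr : ∀ p, rk p ≤ r)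
    {π σ : Phat P → ℝ} (h : IsRow π σ) : RowB rk r π = σ :=
  (isRow_RowB hcov hr π).unique hcov hr h

theorem RowB_iterate_bot (ℓ : ℕ) (π : Phat P → ℝ) : (RowB rk r)^[ℓ] π ⊥ = π ⊥ := by
  induction ℓ with
  | zero => rfl
  | succ ℓ ih =>
    rw [Function.iterate_succ_apply']
    exact (applyB_bot _ _).trans ih

theorem RowB_iterate_topHat (ℓ : ℕ) (π : Phat P → ℝ) :
    (RowB rk r)^[ℓ] π (topHat P) = π (topHat P) := by
  induction ℓ with
  | zero => rfl
  | succ ℓ ih =>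
    rw [Function.iterate_succ_apply']
    exact (applyB_topHat _ _).trans ih

theorem RowB_pos {π : Phat P → ℝ} (hπ : ∀ x, 0 < π x) (x : Phat P) : 0 < RowB rk r π x := by
  have key : ∀ w : List ℕ, ∀ x, 0 < applyB rk w π x := by
    intro w
    induction w with
    | nil => exact hπ
    | cons i w ih =>
      intro x
      rw [applyB_cons, rankToggleB]
      split_ifs with h
      · obtain ⟨p, -, rfl⟩ := h
        exact div_pos (covSumBelow_pos ih p) (mul_pos (ih _) (covSumAboveInv_pos ih p))
      · exact ih x
  exact key _ x

theorem RowB_iterate_pos {π : Phat P → ℝ} (hπ : ∀ x, 0 < π x) (ℓ : ℕ) :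
    ∀ x, 0 < (RowB rk r)^[ℓ] π x := by
  induction ℓ with
  | zero => exact hπ
  | succ ℓ ih =>
    rw [Function.iterate_succ_apply']
    exact RowB_pos ih

/-- Rowvacuation agrees on rank `k` with the `(k+1)`-st iterate of rowmotion. -/
theorem RvacB_emb (hcov : ∀ p q : P, p ⋖ q → rk q = rk p + 1) (hr : ∀ p, rk p ≤ r)
    (π : Phat P → ℝ) (p : P) :
    RvacB rk r π (emb p) = (RowB rk r)^[rk p + 1] π (emb p) := by
  have key : ∀ m s, s + m = r + 1 → ∀ p, applyB rk ((List.range' s m).foldr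
      (fun k acc => (List.range (r + 1)).drop (r - k) ++ acc) []) π (emb p) =
        (RowB rk r)^[min m (rk p + 1)] π (emb p) := by
    intro m
    induction m with
    | zero => simp [applyB]
    | succ m ih =>
      intro s hs p
      rw [List.range'_succ, List.foldr_cons, applyB_append, show r - s = m by omega]
      specialize ih (s + 1) (by omega)
      set τ := applyB rk ((List.range' (s + 1) m).foldr
        (fun k acc => (List.range (r + 1)).drop (r - k) ++ acc) []) π with hτ
      induction hk : r - rk p using Nat.strong_induction_on generalizing p with
      | _ k ihk =>
        rw [applyB_drop_range hcov hr τ (by omega)]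
        split_ifs with hp
        · rw [ih, min_eq_right (by omega), min_eq_right (by omega)]
        · rw [min_eq_left (by omega), Function.iterate_succ_apply',
            (isRow_RowB hcov hr _).apply_emb,
            ← Function.iterate_succ_apply' (RowB rk r), ih, min_eq_left (by omega)]
          congr 1
          · refine covSumBelow_congr ?_ fun q hq => ?_
            · rw [hτ, applyB_bot, RowB_iterate_bot]
            · have := hcov q p hq
              rw [ih, min_eq_left (by omega)]
          · congr 1
            refine covSumAboveInv_congr ?_ fun q hq => ?_
            · rw [applyB_topHat, hτ, applyB_topHat, RowB_iterate_topHat]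
            · have := hcov p q hq
              have := hr q
              rw [ihk (r - rk q) (by omega) q rfl, min_eq_left (by omega)]
  have := key (r + 1) 0 (by omega) p
  rw [← List.range_eq_range', min_eq_right (Nat.succ_le_succ (hr p))] at this
  exact this

end Graded

section Coordinates

variable {T : Type} [Fintype T]

/-- The function on `ℕ × ℕ` which extends `f` by zero along the coordinates `c`. -/
noncomputable def coordExt (c : T → ℕ × ℕ) (f : T → ℝ) (i j : ℕ) : ℝ :=
  ∑ u, if c u = (i, j) then f u else 0

theorem coordExt_apply {c : T → ℕ × ℕ} (hc : Function.Injective c) (f : T → ℝ) {i j : ℕ} {v : T}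
    (hv : c v = (i, j)) : coordExt c f i j = f v := by
  rw [coordExt, Finset.sum_eq_single v, if_pos hv]
  · intro u _ hu
    rw [if_neg fun h => hu (hc (h.trans hv.symm))]
  · exact fun h => absurd (Finset.mem_univ v) h

theorem coordExt_eq_zero {c : T → ℕ × ℕ} (f : T → ℝ) {i j : ℕ} (h : ∀ u, c u ≠ (i, j)) :
    coordExt c f i j = 0 :=
  Finset.sum_eq_zero fun u _ => if_neg (h u)

theorem coordExt_inv {c : T → ℕ × ℕ} (hc : Function.Injective c) (f : T → ℝ) (i j : ℕ) :
    coordExt c (fun u => (f u)⁻¹) i j = (coordExt c f i j)⁻¹ := by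
  by_cases h : ∃ v, c v = (i, j)
  · obtain ⟨v, hv⟩ := h
    rw [coordExt_apply hc _ hv, coordExt_apply hc _ hv]
  · push Not at h
    rw [coordExt_eq_zero _ h, coordExt_eq_zero _ h, inv_zero]

theorem sum_ite_or (c : T → ℕ × ℕ) (f : T → ℝ) {a b : ℕ × ℕ} (hab : a ≠ b) (r : T → Prop)
    (hr : ∀ u, r u ↔ c u = a ∨ c u = b) :
    (∑ u, if r u then f u else 0) = coordExt c f a.1 a.2 + coordExt c f b.1 b.2 := by
  rw [coordExt, coordExt, ← Finset.sum_add_distrib]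
  refine Finset.sum_congr rfl fun u _ => ?_
  by_cases ha : c u = a
  · simp [hr, ha, hab]
  · simp [hr, ha]

end Coordinates

section Rect

variable {p q : ℕ}

/-- The element `(i, j)` of the rectangle. -/
def rectMk (i j : ℕ) (h : 1 ≤ i ∧ i ≤ p ∧ 1 ≤ j ∧ j ≤ q) : RectP p q := ⟨(i, j), h⟩

@[simp]
theorem rectMk_val (i j : ℕ) (h : 1 ≤ i ∧ i ≤ p ∧ 1 ≤ j ∧ j ≤ q) :
    (rectMk i j h).val = (i, j) := rfl

theorem rect_val_injective : Function.Injective (fun u : RectP p q => u.val) :=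
  Subtype.val_injective

theorem rect_le_iff {u v : RectP p q} : u ≤ v ↔ u.val.1 ≤ v.val.1 ∧ u.val.2 ≤ v.val.2 := Iff.rfl

theorem rect_ext {u v : RectP p q} (h₁ : u.val.1 = v.val.1) (h₂ : u.val.2 = v.val.2) : u = v :=
  Subtype.ext (Prod.ext h₁ h₂)

theorem rect_lt_iff {u v : RectP p q} : u < v ↔
    u.val.1 ≤ v.val.1 ∧ u.val.2 ≤ v.val.2 ∧ u.val.1 + u.val.2 < v.val.1 + v.val.2 := by
  rw [lt_iff_le_not_ge, rect_le_iff, rect_le_iff]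
  omega

theorem rect_covBy_iff {u v : RectP p q} : u ⋖ v ↔
    (u.val.1 + 1 = v.val.1 ∧ u.val.2 = v.val.2) ∨
      (u.val.1 = v.val.1 ∧ u.val.2 + 1 = v.val.2) := by
  have hu := u.2
  have hv := v.2
  constructor
  · rintro ⟨h, hc⟩
    rw [rect_lt_iff] at h
    by_contra! hne
    by_cases h₁ : u.val.1 = v.val.1
    · refine @hc (rectMk u.val.1 (u.val.2 + 1) (by omega)) ?_ ?_ <;>
        rw [rect_lt_iff, rectMk_val] <;> dsimp only <;> omega
    · refine @hc (rectMk (u.val.1 + 1) u.val.2 (by omega)) ?_ ?_ <;>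
        rw [rect_lt_iff, rectMk_val] <;> dsimp only <;> omega
  · intro h
    refine ⟨by rw [rect_lt_iff]; omega, fun w hw hw' => ?_⟩
    rw [rect_lt_iff] at hw hw'
    omega

theorem rect_isMin_iff {v : RectP p q} : IsMin v ↔ v.val.1 = 1 ∧ v.val.2 = 1 := by
  have hv := v.2
  constructor
  · intro h
    have := @h (rectMk 1 1 (by omega)) (rect_le_iff.2 (by rw [rectMk_val]; dsimp only; omega))
    rw [rect_le_iff, rectMk_val] at this
    dsimp only at this
    omega
  · intro h u _
    have hu := u.2
    rw [rect_le_iff]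
    omega

theorem rect_isMax_iff {v : RectP p q} : IsMax v ↔ v.val.1 = p ∧ v.val.2 = q := by
  have hv := v.2
  constructor
  · intro h
    have := @h (rectMk p q (by omega)) (rect_le_iff.2 (by rw [rectMk_val]; dsimp only; omega))
    rw [rect_le_iff, rectMk_val] at this
    dsimp only at this
    omega
  · intro h u _
    have hu := u.2
    rw [rect_le_iff]
    omega

theorem rkRect_covBy (u v : RectP p q) (h : u ⋖ v) : rkRect p q v = rkRect p q u + 1 := by
  have hu := u.2
  rw [rect_covBy_iff] at h
  simp only [rkRect]
  omega

theorem rkRect_le (u : RectP p q) : rkRect p q u ≤ p + q - 2 := by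
  have hu := u.2
  simp only [rkRect]
  omega

/-- The values of a labeling of the rectangle, extended by zero to `ℕ × ℕ`. -/
noncomputable def rectExt (σ : Phat (RectP p q) → ℝ) : ℕ → ℕ → ℝ :=
  coordExt (fun u : RectP p q => u.val) fun u => σ (emb u)

theorem rectExt_apply (σ : Phat (RectP p q) → ℝ) {i j : ℕ} (h : 1 ≤ i ∧ i ≤ p ∧ 1 ≤ j ∧ j ≤ q) :
    rectExt σ i j = σ (emb (rectMk i j h)) :=
  coordExt_apply rect_val_injective _ rfl

theorem rectExt_eq (σ : Phat (RectP p q) → ℝ) {u : RectP p q} {i j : ℕ} (hi : u.val.1 = i)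
    (hj : u.val.2 = j) : rectExt σ i j = σ (emb u) :=
  coordExt_apply rect_val_injective _ (Prod.ext hi hj)

theorem rectExt_eq_zero (σ : Phat (RectP p q) → ℝ) {i j : ℕ}
    (h : ¬ (1 ≤ i ∧ i ≤ p ∧ 1 ≤ j ∧ j ≤ q)) : rectExt σ i j = 0 := by
  refine coordExt_eq_zero _ fun u hu => h ?_
  have := u.2
  simp only [hu] at this
  exact this

theorem sum_covBy_rect (f : RectP p q → ℝ) (v : RectP p q) :
    (∑ u, if u ⋖ v then f u else 0) =
      coordExt (fun u : RectP p q => u.val) f (v.val.1 - 1) v.val.2 +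
        coordExt (fun u : RectP p q => u.val) f v.val.1 (v.val.2 - 1) := by
  have hv := v.2
  refine sum_ite_or (fun u : RectP p q => u.val) f (a := (v.val.1 - 1, v.val.2))
    (b := (v.val.1, v.val.2 - 1)) ?_ _ fun u => ?_
  · rw [Ne, Prod.ext_iff]
    dsimp only
    omega
  · have hu := u.2
    rw [rect_covBy_iff, Prod.ext_iff, Prod.ext_iff]
    dsimp only
    omega

theorem sum_covBy_rect' (f : RectP p q → ℝ) (v : RectP p q) :
    (∑ u, if v ⋖ u then f u else 0) =
      coordExt (fun u : RectP p q => u.val) f (v.val.1 + 1) v.val.2 +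
        coordExt (fun u : RectP p q => u.val) f v.val.1 (v.val.2 + 1) := by
  refine sum_ite_or (fun u : RectP p q => u.val) f (a := (v.val.1 + 1, v.val.2))
    (b := (v.val.1, v.val.2 + 1)) ?_ _ fun u => ?_
  · rw [Ne, Prod.ext_iff]
    dsimp only
    omega
  · rw [rect_covBy_iff, Prod.ext_iff, Prod.ext_iff]
    dsimp only
    omega

theorem covSumBelow_rect (σ : Phat (RectP p q) → ℝ) (v : RectP p q) :
    covSumBelow σ (emb v) = rectExt σ (v.val.1 - 1) v.val.2 + rectExt σ v.val.1 (v.val.2 - 1) +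
      if v.val.1 = 1 ∧ v.val.2 = 1 then σ ⊥ else 0 := by
  simp only [covSumBelow_emb, sum_covBy_rect, rect_isMin_iff, rectExt]

theorem covSumAboveInv_rect (σ : Phat (RectP p q) → ℝ) (v : RectP p q) :
    covSumAboveInv σ (emb v) =
      (rectExt σ (v.val.1 + 1) v.val.2)⁻¹ + (rectExt σ v.val.1 (v.val.2 + 1))⁻¹ +
        if v.val.1 = p ∧ v.val.2 = q then (σ (topHat _))⁻¹ else 0 := by
  simp only [covSumAboveInv_emb, sum_covBy_rect', rect_isMax_iff, rectExt,
    coordExt_inv rect_val_injective]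

end Rect

section PathMatrices

variable {P : Type} [Fintype P] [PartialOrder P]

/-- The diagonal matrix of the weights `π(v) / ∑_{u ⋖ v} π(u)`. -/
noncomputable def downMat (π : Phat P → ℝ) : Matrix P P ℝ :=
  Matrix.diagonal fun v => π (emb v) / covSumBelow π (emb v)

/-- The diagonal matrix of the weights `1 / (π(v) ∑_{v ⋖ u} 1/π(u))`. -/
noncomputable def upMat (π : Phat P → ℝ) : Matrix P P ℝ :=
  Matrix.diagonal fun v => (π (emb v) * covSumAboveInv π (emb v))⁻¹

/-- The matrix of the covering relation. -/
noncomputable def covMat (P : Type) [PartialOrder P] : Matrix P P ℝ :=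
  Matrix.of fun u v => if v ⋖ u then 1 else 0

theorem downMat_mul_apply (π : Phat P → ℝ) (M : Matrix P P ℝ) (u v : P) :
    (downMat π * M) u v = π (emb u) / covSumBelow π (emb u) * M u v :=
  Matrix.diagonal_mul _ _ _ _

theorem mul_downMat_apply (π : Phat P → ℝ) (M : Matrix P P ℝ) (u v : P) :
    (M * downMat π) u v = M u v * (π (emb v) / covSumBelow π (emb v)) :=
  Matrix.mul_diagonal _ _ _ _

theorem upMat_mul_apply (π : Phat P → ℝ) (M : Matrix P P ℝ) (u v : P) :
    (upMat π * M) u v = (π (emb u) * covSumAboveInv π (emb u))⁻¹ * M u v :=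
  Matrix.diagonal_mul _ _ _ _

theorem mul_upMat_apply (π : Phat P → ℝ) (M : Matrix P P ℝ) (u v : P) :
    (M * upMat π) u v = M u v * (π (emb v) * covSumAboveInv π (emb v))⁻¹ :=
  Matrix.mul_diagonal _ _ _ _

theorem IsRow.downMat_eq {π σ : Phat P → ℝ} (h : IsRow π σ) (hπ : ∀ x, 0 < π x)
    (hσ : ∀ x, 0 < σ x) : downMat π = upMat σ := by
  rw [downMat, upMat]
  congr 1
  funext v
  have h₁ := covSumBelow_pos hπ v
  have h₂ := covSumAboveInv_pos hσ v
  have h₃ := hπ (emb v)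
  rw [h.apply_emb]
  field_simp

end PathMatrices

section RectPaths

variable {p q : ℕ}

theorem eq_bot_mul_downPath {σ : Phat (RectP p q) → ℝ} (hσ : ∀ x, 0 < σ x) {d : RectP p q}
    (hd : d.val = (1, 1)) (k : ℕ) (v : RectP p q) (hv : v.val.1 + v.val.2 = k + 2) :
    σ (emb v) = σ ⊥ * ((downMat σ * covMat (RectP p q)) ^ k * downMat σ) v d := by
  rw [Prod.ext_iff] at hd
  dsimp only at hd
  induction k generalizing v with
  | zero =>
    have hv' := v.2
    obtain rfl : v = d := rect_ext (by omega) (by omega)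
    rw [pow_zero, one_mul, downMat, Matrix.diagonal_apply_eq, covSumBelow_rect, if_pos hd,
      rectExt_eq_zero _ (by omega), rectExt_eq_zero _ (by omega)]
    have := hσ ⊥
    field_simp
    ring
  | succ k ih =>
    have hpos := covSumBelow_pos hσ v
    have hsum : covSumBelow σ (emb v) =
        σ ⊥ * (covMat (RectP p q) * ((downMat σ * covMat (RectP p q)) ^ k * downMat σ)) v d := by
      rw [covSumBelow_emb, if_neg (by rw [rect_isMin_iff]; omega), add_zero, Matrix.mul_apply,
        Finset.mul_sum]
      refine Finset.sum_congr rfl fun u _ => ?_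
      rw [covMat, Matrix.of_apply]
      split_ifs with hu
      · rw [rect_covBy_iff] at hu
        rw [one_mul]
        exact ih u (by omega)
      · ring
    rw [pow_succ', mul_assoc, mul_assoc, downMat_mul_apply, mul_left_comm,
      ← hsum]
    field_simp

theorem inv_eq_inv_topHat_mul_upPath {σ : Phat (RectP p q) → ℝ} (hσ : ∀ x, 0 < σ x)
    {t : RectP p q} (ht : t.val = (p, q)) (k : ℕ) (v : RectP p q)
    (hv : v.val.1 + v.val.2 + k = p + q) :
    (σ (emb v))⁻¹ = (σ (topHat _))⁻¹ * (upMat σ * (covMat (RectP p q) * upMat σ) ^ k) t v := by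
  rw [Prod.ext_iff] at ht
  dsimp only at ht
  induction k generalizing v with
  | zero =>
    have hv' := v.2
    obtain rfl : v = t := rect_ext (by omega) (by omega)
    rw [pow_zero, mul_one, upMat, Matrix.diagonal_apply_eq, covSumAboveInv_rect, if_pos ht,
      rectExt_eq_zero _ (by omega), rectExt_eq_zero _ (by omega)]
    have := hσ (topHat _)
    have := hσ (emb v)
    simp
    field_simp
  | succ k ih =>
    have hpos := covSumAboveInv_pos hσ v
    have hsum : covSumAboveInv σ (emb v) =
        (σ (topHat _))⁻¹ *
          ((upMat σ * (covMat (RectP p q) * upMat σ) ^ k) * covMat (RectP p q)) t v := by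
      rw [covSumAboveInv_emb, if_neg (by rw [rect_isMax_iff]; omega), add_zero, Matrix.mul_apply,
        Finset.mul_sum]
      refine Finset.sum_congr rfl fun u _ => ?_
      rw [covMat, Matrix.of_apply]
      split_ifs with hu
      · rw [rect_covBy_iff] at hu
        rw [mul_one]
        exact ih u (by omega)
      · ring
    rw [pow_succ, ← mul_assoc, ← mul_assoc, mul_upMat_apply, ← mul_assoc, ← hsum]
    have := hσ (emb v)
    field_simp

/-- The matrix of the jumps `u ▸ v`, weighted by `σ(u) / σ(v)`: jumps go down by one rank and
strictly decrease the first coordinate. -/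
noncomputable def jumpMat (σ : Phat (RectP p q) → ℝ) : Matrix (RectP p q) (RectP p q) ℝ :=
  Matrix.of fun u v => if v.val.1 < u.val.1 ∧ v.val.1 + v.val.2 + 1 = u.val.1 + u.val.2 then
    σ (emb u) / σ (emb v) else 0

theorem covMat_mul_jumpMat (σ : Phat (RectP p q) → ℝ) (u v : RectP p q) :
    (covMat (RectP p q) * jumpMat σ) u v =
      ((if v.val.1 + 1 < u.val.1 ∧ v.val.1 + v.val.2 + 2 = u.val.1 + u.val.2 then
        rectExt σ (u.val.1 - 1) u.val.2 else 0) +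
      if v.val.1 < u.val.1 ∧ v.val.1 + v.val.2 + 2 = u.val.1 + u.val.2 then
        rectExt σ u.val.1 (u.val.2 - 1) else 0) / σ (emb v) := by
  rw [Matrix.mul_apply]
  have h (w : RectP p q) : covMat (RectP p q) u w * jumpMat σ w v =
      if w ⋖ u then jumpMat σ w v else 0 := by
    rw [covMat, Matrix.of_apply, ite_mul, one_mul, zero_mul]
  simp only [h]
  rw [sum_covBy_rect (fun w => jumpMat σ w v), add_div]
  have hu := u.2
  congr 1
  · by_cases h₁ : 1 ≤ u.val.1 - 1
    · rw [coordExt_apply (v := rectMk (u.val.1 - 1) u.val.2 (by omega)) rect_val_injective _ rfl,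
        rectExt_apply σ (i := u.val.1 - 1) (j := u.val.2) (by omega), jumpMat, Matrix.of_apply,
        rectMk_val, ite_div, zero_div]
      refine if_congr ?_ rfl rfl
      dsimp only
      omega
    · rw [rectExt_eq_zero σ (i := u.val.1 - 1) (by omega), coordExt_eq_zero, ite_self, zero_div]
      intro w hw
      have hw' := w.2
      rw [Prod.ext_iff] at hw
      dsimp only at hw
      omega
  · by_cases h₁ : 1 ≤ u.val.2 - 1
    · rw [coordExt_apply (v := rectMk u.val.1 (u.val.2 - 1) (by omega)) rect_val_injective _ rfl,
        rectExt_apply σ (j := u.val.2 - 1) (i := u.val.1) (by omega), jumpMat, Matrix.of_apply,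
        rectMk_val, ite_div, zero_div]
      refine if_congr ?_ rfl rfl
      dsimp only
      omega
    · rw [rectExt_eq_zero σ (j := u.val.2 - 1) (by omega), coordExt_eq_zero, ite_self, zero_div]
      intro w hw
      have hw' := w.2
      rw [Prod.ext_iff] at hw
      dsimp only at hw
      omega

theorem jumpMat_mul_covMat (σ : Phat (RectP p q) → ℝ) (u v : RectP p q) :
    (jumpMat σ * covMat (RectP p q)) u v = σ (emb u) *
      ((if v.val.1 + 1 < u.val.1 ∧ v.val.1 + v.val.2 + 2 = u.val.1 + u.val.2 then
        (rectExt σ (v.val.1 + 1) v.val.2)⁻¹ else 0) +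
      if v.val.1 < u.val.1 ∧ v.val.1 + v.val.2 + 2 = u.val.1 + u.val.2 then
        (rectExt σ v.val.1 (v.val.2 + 1))⁻¹ else 0) := by
  rw [Matrix.mul_apply]
  have h (w : RectP p q) : jumpMat σ u w * covMat (RectP p q) w v =
      if v ⋖ w then jumpMat σ u w else 0 := by
    rw [covMat, Matrix.of_apply, mul_ite, mul_one, mul_zero]
  simp only [h]
  rw [sum_covBy_rect' (fun w => jumpMat σ u w), mul_add]
  have hu := v.2
  congr 1
  · by_cases h₁ : v.val.1 + 1 ≤ p
    · rw [coordExt_apply (v := rectMk (v.val.1 + 1) v.val.2 (by omega)) rect_val_injective _ rfl,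
        rectExt_apply σ (i := v.val.1 + 1) (j := v.val.2) (by omega), jumpMat, Matrix.of_apply,
        rectMk_val, mul_ite, mul_zero, div_eq_mul_inv]
      refine if_congr ?_ rfl rfl
      dsimp only
      omega
    · rw [rectExt_eq_zero σ (i := v.val.1 + 1) (by omega), coordExt_eq_zero, inv_zero, ite_self,
        mul_zero]
      intro w hw
      have hw' := w.2
      rw [Prod.ext_iff] at hw
      dsimp only at hw
      omega
  · by_cases h₁ : v.val.2 + 1 ≤ q
    · rw [coordExt_apply (v := rectMk v.val.1 (v.val.2 + 1) (by omega)) rect_val_injective _ rfl,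
        rectExt_apply σ (j := v.val.2 + 1) (i := v.val.1) (by omega), jumpMat, Matrix.of_apply,
        rectMk_val, mul_ite, mul_zero, div_eq_mul_inv]
      refine if_congr ?_ rfl rfl
      dsimp only
      omega
    · rw [rectExt_eq_zero σ (j := v.val.2 + 1) (by omega), coordExt_eq_zero, inv_zero, ite_self,
        mul_zero]
      intro w hw
      have hw' := w.2
      rw [Prod.ext_iff] at hw
      dsimp only at hw
      omega

theorem rectExt_pos {σ : Phat (RectP p q) → ℝ} (hσ : ∀ x, 0 < σ x) {i j : ℕ}
    (h : 1 ≤ i ∧ i ≤ p ∧ 1 ≤ j ∧ j ≤ q) : 0 < rectExt σ i j := by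
  rw [rectExt_apply σ h]
  exact hσ _

/-- Jumps intertwine the two kinds of weighted steps. -/
theorem semiconjBy_jumpMat {σ : Phat (RectP p q) → ℝ} (hσ : ∀ x, 0 < σ x) :
    SemiconjBy (jumpMat σ) (covMat (RectP p q) * upMat σ) (downMat σ * covMat (RectP p q)) := by
  rw [SemiconjBy, ← mul_assoc, mul_assoc (downMat σ)]
  ext u v
  rw [mul_upMat_apply, downMat_mul_apply, covMat_mul_jumpMat, jumpMat_mul_covMat]
  have hu := u.2
  have hv := v.2
  have hbelow := covSumBelow_pos hσ u
  have habove := covSumAboveInv_pos hσ v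
  have hσu := hσ (emb u)
  have hσv := hσ (emb v)
  by_cases hrk : v.val.1 + v.val.2 + 2 = u.val.1 + u.val.2
  · rcases lt_trichotomy (v.val.1 + 1) u.val.1 with h | h | h
    · rw [if_pos ⟨h, hrk⟩, if_pos ⟨by omega, hrk⟩, if_pos ⟨h, hrk⟩, if_pos ⟨by omega, hrk⟩]
      have h₁ := covSumBelow_rect σ u
      have h₂ := covSumAboveInv_rect σ v
      rw [if_neg (by omega), add_zero] at h₁ h₂
      rw [← h₁, ← h₂]
      field_simp
    · rw [if_neg (by omega), if_pos ⟨by omega, hrk⟩, if_neg (by omega), if_pos ⟨by omega, hrk⟩,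
        zero_add, zero_add]
      have h₁ := covSumBelow_rect σ u
      have h₂ := covSumAboveInv_rect σ v
      rw [if_neg (by omega), add_zero] at h₁ h₂
      rw [h, show v.val.1 = u.val.1 - 1 by omega, show v.val.2 + 1 = u.val.2 by omega,
        show v.val.2 = u.val.2 - 1 by omega] at h₂
      rw [h₁, h₂, show v.val.1 = u.val.1 - 1 by omega, show v.val.2 + 1 = u.val.2 by omega]
      have h₃ := rectExt_pos hσ (i := u.val.1 - 1) (j := u.val.2) (by omega)
      have h₄ := rectExt_pos hσ (i := u.val.1) (j := u.val.2 - 1) (by omega)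
      field_simp
    · rw [if_neg (by omega), if_neg (by omega), if_neg (by omega), if_neg (by omega)]
      simp
  · rw [if_neg (by omega), if_neg (by omega), if_neg (by omega), if_neg (by omega)]
    simp

/-- Path sums between the two edges `(·, q)` and `(·, 1)` of the rectangle: moving both
endpoints down by one converts down-weights into up-weights. -/
theorem downPath_eq_upPath {σ : Phat (RectP p q) → ℝ} (hσ : ∀ x, 0 < σ x) (k : ℕ)
    {u u' d d' : RectP p q} (hu : u.val.2 = q) (hu' : u'.val.2 = q) (hd : d.val.2 = 1)
    (hd' : d'.val.2 = 1) (huu' : u.val.1 = u'.val.1 + 1) (hdd' : d.val.1 = d'.val.1 + 1) :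
    ((downMat σ * covMat (RectP p q)) ^ k * downMat σ) u d =
      (upMat σ * (covMat (RectP p q) * upMat σ) ^ k) u' d' := by
  have key := congrFun (congrFun ((semiconjBy_jumpMat hσ).pow_right k) u) d'
  have bu' := u'.2
  have bd' := d'.2
  have bu := u.2
  have bd := d.2
  have hrow (w : RectP p q) : jumpMat σ u w =
      if w = u' then (σ (emb u') * covSumAboveInv σ (emb u'))⁻¹ else 0 := by
    have bw := w.2
    rw [jumpMat, Matrix.of_apply]
    split_ifs with h₁ h₂ h₂
    · rw [h₂, covSumAboveInv_rect, if_neg (by omega), rectExt_eq_zero σ (j := u'.val.2 + 1)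
        (by omega), rectExt_eq σ huu' (hu.trans hu'.symm)]
      simp [div_eq_mul_inv]
    · exact absurd (rect_ext (by omega) (by omega)) h₂
    · subst h₂
      omega
    · rfl
  have hcol (w : RectP p q) : jumpMat σ w d' =
      if w = d then σ (emb d) / covSumBelow σ (emb d) else 0 := by
    have bw := w.2
    rw [jumpMat, Matrix.of_apply]
    split_ifs with h₁ h₂ h₂
    · rw [h₂, covSumBelow_rect, if_neg (by omega), rectExt_eq_zero σ (j := d.val.2 - 1)
        (by omega),
        rectExt_eq σ (u := d') (by omega) (hd'.trans hd.symm)]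
      simp
    · exact absurd (rect_ext (by omega) (by omega)) h₂
    · subst h₂
      omega
    · rfl
  rw [Matrix.mul_apply, Matrix.mul_apply] at key
  simp only [hrow, hcol, ite_mul, zero_mul, mul_ite, mul_zero, Finset.sum_ite_eq',
    Finset.mem_univ, if_true] at key
  rw [mul_downMat_apply, upMat_mul_apply, key]

end RectPaths

section Reciprocity

variable {p q : ℕ} {s : ℕ → Phat (RectP p q) → ℝ}

theorem upPath_shift (hpos : ∀ ℓ x, 0 < s ℓ x) (hrow : ∀ ℓ, IsRow (s ℓ) (s (ℓ + 1)))
    (ℓ k m : ℕ) {u u' d d' : RectP p q} (hu : u.val.2 = q) (hu' : u'.val.2 = q)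
    (hd : d.val.2 = 1) (hd' : d'.val.2 = 1) (huu' : u.val.1 = u'.val.1 + m)
    (hdd' : d.val.1 = d'.val.1 + m) :
    (upMat (s (ℓ + m)) * (covMat (RectP p q) * upMat (s (ℓ + m))) ^ k) u d =
      (upMat (s ℓ) * (covMat (RectP p q) * upMat (s ℓ)) ^ k) u' d' := by
  induction m generalizing u d with
  | zero =>
    obtain rfl : u = u' := rect_ext (by omega) (by omega)
    obtain rfl : d = d' := rect_ext (by omega) (by omega)
    rfl
  | succ m ih =>
    have bu := u.2
    have bd := d.2
    have bu' := u'.2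
    have bd' := d'.2
    let u₁ : RectP p q := rectMk (u'.val.1 + m) q (by omega)
    let d₁ : RectP p q := rectMk (d'.val.1 + m) 1 (by omega)
    rw [← ih (u := u₁) (d := d₁) rfl rfl rfl rfl,
      ← downPath_eq_upPath (hpos (ℓ + m)) k (u := u) (d := d) hu rfl hd rfl huu' hdd',
      (hrow (ℓ + m)).downMat_eq (hpos _) (hpos _), ← add_assoc]
    have : SemiconjBy (upMat (s (ℓ + m + 1))) (covMat (RectP p q) * upMat (s (ℓ + m + 1)))
        (upMat (s (ℓ + m + 1)) * covMat (RectP p q)) := by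
      rw [SemiconjBy, mul_assoc]
    rw [(this.pow_right k).eq]

/-- Reciprocity on the edge `(·, 1)` of the rectangle. -/
theorem reciprocity_edge (hpos : ∀ ℓ x, 0 < s ℓ x) (hrow : ∀ ℓ, IsRow (s ℓ) (s (ℓ + 1)))
    {u w : RectP p q} (hu : u.val.2 = 1) (hw : w.val.2 = q) (huw : u.val.1 + w.val.1 = p + 1)
    (ℓ : ℕ) : s (ℓ + u.val.1) (emb u) * s ℓ (emb w) = s ℓ ⊥ * s (ℓ + u.val.1) (topHat _) := by
  have bu := u.2
  have bw := w.2
  let t : RectP p q := rectMk p q (by omega)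
  let b : RectP p q := rectMk 1 1 (by omega)
  have h₁ := inv_eq_inv_topHat_mul_upPath (hpos (ℓ + u.val.1)) (t := t) rfl
    (p - u.val.1 + (q - 1)) u (by omega)
  have h₂ := eq_bot_mul_downPath (hpos ℓ) (d := b) rfl (p - u.val.1 + (q - 1)) w (by omega)
  have h₃ := upPath_shift hpos hrow (ℓ + 1) (p - u.val.1 + (q - 1)) (u.val.1 - 1)
    (u := t) (u' := w) (d := u) (d' := b) rfl hw hu rfl
    (by simp only [t, rectMk_val]; omega) (by simp only [b, rectMk_val]; omega)
  have hS : SemiconjBy (upMat (s (ℓ + 1))) (covMat (RectP p q) * upMat (s (ℓ + 1)))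
      (upMat (s (ℓ + 1)) * covMat (RectP p q)) := by
    rw [SemiconjBy, mul_assoc]
  rw [(hrow ℓ).downMat_eq (hpos _) (hpos _), ← (hS.pow_right _).eq, ← h₃,
    show ℓ + 1 + (u.val.1 - 1) = ℓ + u.val.1 by omega] at h₂
  have p₁ := hpos (ℓ + u.val.1) (emb u)
  have p₂ := hpos (ℓ + u.val.1) (topHat _)
  rw [h₂, mul_left_comm]
  congr 1
  rw [inv_eq_iff_eq_inv, mul_inv, inv_inv] at h₁
  rw [h₁, mul_assoc, inv_mul_cancel₀, mul_one]
  intro h0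
  rw [h0] at h₁
  simp at h₁
  exact p₁.ne' h₁

theorem IsRow.rect_eq {π σ : Phat (RectP p q) → ℝ} (h : IsRow π σ) (hπ : ∀ x, 0 < π x)
    (hσ : ∀ x, 0 < σ x) {i j : ℕ} (hij : 1 ≤ i ∧ i ≤ p ∧ 1 ≤ j ∧ j ≤ q) :
    rectExt σ i j * rectExt π i j * ((rectExt σ (i + 1) j)⁻¹ + (rectExt σ i (j + 1))⁻¹ +
      if i = p ∧ j = q then (σ (topHat _))⁻¹ else 0) =
    rectExt π (i - 1) j + rectExt π i (j - 1) + if i = 1 ∧ j = 1 then π ⊥ else 0 := by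
  have h₁ : covSumBelow π (emb (rectMk i j hij)) =
      rectExt π (i - 1) j + rectExt π i (j - 1) + if i = 1 ∧ j = 1 then π ⊥ else 0 :=
    covSumBelow_rect π (rectMk i j hij)
  have h₂ : covSumAboveInv σ (emb (rectMk i j hij)) =
      (rectExt σ (i + 1) j)⁻¹ + (rectExt σ i (j + 1))⁻¹ +
        if i = p ∧ j = q then (σ (topHat _))⁻¹ else 0 :=
    covSumAboveInv_rect σ (rectMk i j hij)
  have p₁ := hπ (emb (rectMk i j hij))
  have p₂ := covSumAboveInv_pos hσ (rectMk i j hij)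
  rw [← h₁, ← h₂, rectExt_apply σ hij, rectExt_apply π hij, h.apply_emb]
  field_simp

/-- Reciprocity for birational rowmotion on the rectangle. -/
theorem reciprocity_rectExt (hpos : ∀ ℓ x, 0 < s ℓ x) (hrow : ∀ ℓ, IsRow (s ℓ) (s (ℓ + 1)))
    {a b : ℝ} (ha : ∀ ℓ, s ℓ ⊥ = a) (hb : ∀ ℓ, s ℓ (topHat _) = b) (j : ℕ) (hj : j ≤ q) (i : ℕ)
    (hi : i ≤ p + 1) (ℓ N : ℕ) (hN : N + 1 = ℓ + i + j) :
    rectExt (s N) i j = a * b * (rectExt (s ℓ) (p + 1 - i) (q + 1 - j))⁻¹ := by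
  induction j using Nat.strong_induction_on generalizing i ℓ N with
  | _ j ih =>
    by_cases hin : 1 ≤ i ∧ i ≤ p ∧ 1 ≤ j
    swap
    · rw [rectExt_eq_zero _ (by omega), rectExt_eq_zero _ (by omega), inv_zero, mul_zero]
    obtain ⟨hi₁, hip, hj₁⟩ := hin
    have hapos : 0 < a := ha 0 ▸ hpos 0 ⊥
    have hbpos : 0 < b := hb 0 ▸ hpos 0 (topHat _)
    obtain rfl | ⟨j, rfl⟩ : j = 1 ∨ ∃ k, j = k + 2 := by
      rcases j with _ | _ | k
      · omega
      · exact Or.inl rfl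
      · exact Or.inr ⟨k, rfl⟩
    · have h := reciprocity_edge hpos hrow (u := rectMk i 1 (by omega))
        (w := rectMk (p + 1 - i) q (by omega)) rfl rfl (by simp only [rectMk_val]; omega) ℓ
      rw [ha, hb, rectMk_val, show ℓ + i = N by omega] at h
      rw [rectExt_apply (s N) (by omega), Nat.add_sub_cancel, rectExt_apply (s ℓ) (by omega), ← h]
      have := hpos ℓ (emb (rectMk (p + 1 - i) q (by omega)))
      field_simp
    · obtain ⟨n, rfl⟩ : ∃ n, N = n + 1 := ⟨N - 1, by omega⟩
      have e₁ := ih (j + 1) (by omega) (by omega) i (by omega) ℓ n (by omega)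
      have e₂ := ih (j + 1) (by omega) (by omega) i (by omega) (ℓ + 1) (n + 1) (by omega)
      have e₃ := ih (j + 1) (by omega) (by omega) (i + 1) (by omega) ℓ (n + 1) (by omega)
      have e₄ := ih (j + 1) (by omega) (by omega) (i - 1) (by omega) (ℓ + 1) n (by omega)
      have e₅ := ih j (by omega) (by omega) i (by omega) (ℓ + 1) n (by omega)
      have t₁ := (hrow n).rect_eq (hpos _) (hpos _) (i := i) (j := j + 1) (by omega)
      have t₂ := (hrow ℓ).rect_eq (hpos _) (hpos _) (i := p + 1 - i) (j := q - j) (by omega)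
      rw [if_neg (by omega), add_zero, ha] at t₁
      rw [if_neg (c := p + 1 - i = 1 ∧ q - j = 1) (by omega), add_zero, hb,
        show (if p + 1 - i = p ∧ q - j = q then b⁻¹ else 0) =
          if i = 1 ∧ j + 1 = 1 then b⁻¹ else 0 from if_congr (by omega) rfl rfl] at t₂
      rw [show q + 1 - (j + 1) = q - j by omega] at e₁ e₂ e₃ e₄
      rw [show p + 1 - (i + 1) = p + 1 - i - 1 by omega] at e₃
      rw [show p + 1 - (i - 1) = p + 1 - i + 1 by omega] at e₄
      rw [show q + 1 - j = q - j + 1 by omega] at e₅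
      rw [show q + 1 - (j + 2) = q - j - 1 by omega]
      rw [show j + 1 + 1 = j + 2 by omega, Nat.add_sub_cancel, e₁, e₂, e₃, e₄, e₅] at t₁
      have g := rectExt_pos (hpos ℓ) (i := p + 1 - i) (j := q - j) (by omega)
      have h := rectExt_pos (hpos (ℓ + 1)) (i := p + 1 - i) (j := q - j) (by omega)
      have hδ := rectExt_pos (hpos ℓ) (i := p + 1 - i) (j := q - j - 1) (by omega)
      have hX := rectExt_pos (hpos (n + 1)) (i := i) (j := j + 2) (by omega)
      generalize rectExt (s ℓ) (p + 1 - i) (q - j) = g₀ at *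
      generalize rectExt (s (ℓ + 1)) (p + 1 - i) (q - j) = h₀ at *
      generalize rectExt (s ℓ) (p + 1 - i) (q - j - 1) = δ at *
      generalize rectExt (s (n + 1)) i (j + 2) = X at *
      generalize rectExt (s ℓ) (p + 1 - i - 1) (q - j) = α at *
      generalize (rectExt (s (ℓ + 1)) (p + 1 - i + 1) (q - j))⁻¹ = β at *
      generalize (rectExt (s (ℓ + 1)) (p + 1 - i) (q - j + 1))⁻¹ = γ at *
      have hε : (if i = 1 ∧ j + 1 = 1 then a else 0) =
          a * b * (if i = 1 ∧ j + 1 = 1 then b⁻¹ else 0) := by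
        split_ifs
        · field_simp
        · ring
      rw [hε, ← mul_add, ← mul_add] at t₁
      generalize (if i = 1 ∧ j + 1 = 1 then b⁻¹ else 0) = ε at *
      have t₃ : h₀ * g₀ * (β + γ + ε) = a * b * ((a * b * α⁻¹)⁻¹ + X⁻¹) := by
        have : a * b ≠ 0 := by positivity
        apply mul_left_cancel₀ this
        rw [mul_left_comm, ← t₁]
        field_simp
      rw [t₂, mul_add, mul_inv, inv_inv, mul_inv_cancel_left₀ (by positivity)] at t₃
      have t₄ := add_left_cancel t₃
      rw [t₄]
      field_simp

end Reciprocity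

section Intervals

variable {n : ℕ}

/-- The interval `[i, j]`. -/
def anMk (i j : ℕ) (h : 1 ≤ i ∧ i ≤ j ∧ j ≤ n) : AnP n := ⟨(i, j), h⟩

@[simp]
theorem anMk_val (i j : ℕ) (h : 1 ≤ i ∧ i ≤ j ∧ j ≤ n) : (anMk i j h).val = (i, j) := rfl

theorem an_val_injective : Function.Injective (fun u : AnP n => u.val) := Subtype.val_injective

theorem an_le_iff {u v : AnP n} : u ≤ v ↔ v.val.1 ≤ u.val.1 ∧ u.val.2 ≤ v.val.2 := Iff.rfl

theorem an_lt_iff {u v : AnP n} : u < v ↔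
    v.val.1 ≤ u.val.1 ∧ u.val.2 ≤ v.val.2 ∧ v.val.1 + u.val.2 < u.val.1 + v.val.2 := by
  rw [lt_iff_le_not_ge, an_le_iff, an_le_iff]
  omega

theorem an_covBy_iff {u v : AnP n} : u ⋖ v ↔
    (u.val.1 = v.val.1 + 1 ∧ u.val.2 = v.val.2) ∨
      (u.val.1 = v.val.1 ∧ u.val.2 + 1 = v.val.2) := by
  have hu := u.2
  have hv := v.2
  constructor
  · rintro ⟨h, hc⟩
    rw [an_lt_iff] at h
    by_contra! hne
    by_cases h₁ : u.val.1 = v.val.1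
    · refine @hc (anMk u.val.1 (u.val.2 + 1) (by omega)) ?_ ?_ <;>
        rw [an_lt_iff, anMk_val] <;> dsimp only <;> omega
    · refine @hc (anMk (u.val.1 - 1) u.val.2 (by omega)) ?_ ?_ <;>
        rw [an_lt_iff, anMk_val] <;> dsimp only <;> omega
  · intro h
    refine ⟨by rw [an_lt_iff]; omega, fun w hw hw' => ?_⟩
    rw [an_lt_iff] at hw hw'
    omega

theorem an_isMin_iff {v : AnP n} : IsMin v ↔ v.val.1 = v.val.2 := by
  have hv := v.2
  constructor
  · intro h
    have := @h (anMk v.val.1 v.val.1 (by omega))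
      (an_le_iff.2 (by rw [anMk_val]; dsimp only; omega))
    rw [an_le_iff, anMk_val] at this
    dsimp only at this
    omega
  · intro h w hw
    have := w.2
    rw [an_le_iff] at hw ⊢
    omega

theorem an_isMax_iff {v : AnP n} : IsMax v ↔ v.val.1 = 1 ∧ v.val.2 = n := by
  have hv := v.2
  constructor
  · intro h
    have := @h (anMk 1 n (by omega)) (an_le_iff.2 (by rw [anMk_val]; dsimp only; omega))
    rw [an_le_iff, anMk_val] at this
    dsimp only at this
    omega
  · intro h w hw
    have := w.2
    rw [an_le_iff] at hw ⊢
    omega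

theorem rkAn_covBy (u v : AnP n) (h : u ⋖ v) : rkAn n v = rkAn n u + 1 := by
  have hu := u.2
  have hv := v.2
  rw [an_covBy_iff] at h
  rw [rkAn, rkAn]
  omega

theorem rkAn_le (u : AnP n) : rkAn n u ≤ n - 1 := by
  have hu := u.2
  rw [rkAn]
  omega

/-- The extension by zero to `ℕ × ℕ` of a labeling of `Aⁿ`. -/
noncomputable def anExt (π : Phat (AnP n) → ℝ) : ℕ → ℕ → ℝ :=
  coordExt (fun u : AnP n => u.val) fun u => π (emb u)

theorem anExt_apply (π : Phat (AnP n) → ℝ) {i j : ℕ} (h : 1 ≤ i ∧ i ≤ j ∧ j ≤ n) :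
    anExt π i j = π (emb (anMk i j h)) :=
  coordExt_apply an_val_injective _ rfl

theorem anExt_eq (π : Phat (AnP n) → ℝ) {u : AnP n} {i j : ℕ} (hi : u.val.1 = i)
    (hj : u.val.2 = j) : anExt π i j = π (emb u) :=
  coordExt_apply an_val_injective _ (Prod.ext hi hj)

theorem anExt_eq_zero (π : Phat (AnP n) → ℝ) {i j : ℕ} (h : ¬ (1 ≤ i ∧ i ≤ j ∧ j ≤ n)) :
    anExt π i j = 0 := by
  refine coordExt_eq_zero _ fun u hu => h ?_
  have := u.2
  simp only [hu] at this
  exact this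

theorem anExt_pos {π : Phat (AnP n) → ℝ} (hπ : ∀ x, 0 < π x) {i j : ℕ}
    (h : 1 ≤ i ∧ i ≤ j ∧ j ≤ n) : 0 < anExt π i j := by
  rw [anExt_apply π h]
  exact hπ _

theorem covSumBelow_an (π : Phat (AnP n) → ℝ) (v : AnP n) :
    covSumBelow π (emb v) = anExt π (v.val.1 + 1) v.val.2 + anExt π v.val.1 (v.val.2 - 1) +
      if v.val.1 = v.val.2 then π ⊥ else 0 := by
  have hv := v.2
  simp only [covSumBelow_emb, an_isMin_iff]
  congr 1
  refine sum_ite_or (fun u : AnP n => u.val) (fun u => π (emb u)) (a := (v.val.1 + 1, v.val.2))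
    (b := (v.val.1, v.val.2 - 1)) ?_ _ fun u => ?_
  · rw [Ne, Prod.ext_iff]
    dsimp only
    omega
  · have hu := u.2
    rw [an_covBy_iff, Prod.ext_iff, Prod.ext_iff]
    dsimp only
    omega

theorem covSumAboveInv_an (π : Phat (AnP n) → ℝ) (v : AnP n) :
    covSumAboveInv π (emb v) =
      (anExt π (v.val.1 - 1) v.val.2)⁻¹ + (anExt π v.val.1 (v.val.2 + 1))⁻¹ +
        if v.val.1 = 1 ∧ v.val.2 = n then (π (topHat _))⁻¹ else 0 := by
  have hv := v.2
  simp only [covSumAboveInv_emb, an_isMax_iff, anExt]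
  rw [← coordExt_inv an_val_injective, ← coordExt_inv an_val_injective]
  congr 1
  refine sum_ite_or (fun u : AnP n => u.val) (fun u => (π (emb u))⁻¹)
    (a := (v.val.1 - 1, v.val.2)) (b := (v.val.1, v.val.2 + 1)) ?_ _ fun u => ?_
  · rw [Ne, Prod.ext_iff]
    dsimp only
    omega
  · have hu := u.2
    rw [an_covBy_iff, Prod.ext_iff, Prod.ext_iff]
    dsimp only
    omega

end Intervals

section RowEquations

variable {P : Type} [Fintype P] [PartialOrder P]

theorem isRow_iff {π σ : Phat P → ℝ} (hπ : ∀ x, 0 < π x) (hσ : ∀ x, 0 < σ x) :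
    IsRow π σ ↔ σ ⊥ = π ⊥ ∧ σ (topHat P) = π (topHat P) ∧
      ∀ p, σ (emb p) * π (emb p) * covSumAboveInv σ (emb p) = covSumBelow π (emb p) := by
  have h (p : P) : σ (emb p) = covSumBelow π (emb p) / (π (emb p) * covSumAboveInv σ (emb p)) ↔
      σ (emb p) * π (emb p) * covSumAboveInv σ (emb p) = covSumBelow π (emb p) := by
    rw [eq_div_iff (mul_pos (hπ _) (covSumAboveInv_pos hσ p)).ne', mul_assoc]
  exact ⟨fun ⟨h₁, h₂, h₃⟩ => ⟨h₁, h₂, fun p => (h p).1 (h₃ p)⟩,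
    fun ⟨h₁, h₂, h₃⟩ => ⟨h₁, h₂, fun p => (h p).2 (h₃ p)⟩⟩

theorem isRow_rect {p q : ℕ} {π σ : Phat (RectP p q) → ℝ} (hπ : ∀ x, 0 < π x)
    (hσ : ∀ x, 0 < σ x) (hbot : σ ⊥ = π ⊥) (htop : σ (topHat _) = π (topHat _))
    (h : ∀ i j, 1 ≤ i ∧ i ≤ p ∧ 1 ≤ j ∧ j ≤ q →
      rectExt σ i j * rectExt π i j * ((rectExt σ (i + 1) j)⁻¹ + (rectExt σ i (j + 1))⁻¹ +
        if i = p ∧ j = q then (σ (topHat _))⁻¹ else 0) =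
      rectExt π (i - 1) j + rectExt π i (j - 1) + if i = 1 ∧ j = 1 then π ⊥ else 0) :
    IsRow π σ := by
  refine (isRow_iff hπ hσ).2 ⟨hbot, htop, fun v => ?_⟩
  rw [covSumBelow_rect, covSumAboveInv_rect, ← rectExt_eq σ (u := v) rfl rfl,
    ← rectExt_eq π (u := v) rfl rfl]
  exact h _ _ v.2

variable {n : ℕ} {π σ : Phat (AnP n) → ℝ}

theorem isRow_an (hπ : ∀ x, 0 < π x) (hσ : ∀ x, 0 < σ x) (hbot : σ ⊥ = π ⊥)
    (htop : σ (topHat _) = π (topHat _))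
    (h : ∀ i j, 1 ≤ i ∧ i ≤ j ∧ j ≤ n →
      anExt σ i j * anExt π i j * ((anExt σ (i - 1) j)⁻¹ + (anExt σ i (j + 1))⁻¹ +
        if i = 1 ∧ j = n then (σ (topHat _))⁻¹ else 0) =
      anExt π (i + 1) j + anExt π i (j - 1) + if i = j then π ⊥ else 0) :
    IsRow π σ := by
  refine (isRow_iff hπ hσ).2 ⟨hbot, htop, fun v => ?_⟩
  rw [covSumBelow_an, covSumAboveInv_an, ← anExt_eq σ (u := v) rfl rfl,
    ← anExt_eq π (u := v) rfl rfl]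
  exact h _ _ v.2

theorem IsRow.an_eq (h : IsRow π σ) (hπ : ∀ x, 0 < π x) (hσ : ∀ x, 0 < σ x) {i j : ℕ}
    (hij : 1 ≤ i ∧ i ≤ j ∧ j ≤ n) :
    anExt σ i j * anExt π i j * ((anExt σ (i - 1) j)⁻¹ + (anExt σ i (j + 1))⁻¹ +
      if i = 1 ∧ j = n then (σ (topHat _))⁻¹ else 0) =
    anExt π (i + 1) j + anExt π i (j - 1) + if i = j then π ⊥ else 0 := by
  have := ((isRow_iff hπ hσ).1 h).2.2 (anMk i j hij)
  rw [covSumBelow_an, covSumAboveInv_an, ← anExt_apply σ hij, ← anExt_apply π hij] at this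
  exact this

end RowEquations

section Flip

theorem flipLabelAn_emb (n : ℕ) (π : Phat (AnP n) → ℝ) (p : AnP n) :
    flipLabelAn n π (emb p) = π (emb (flipAn n p)) := by
  have h : ∃ q : AnP n, emb p = emb q := ⟨p, rfl⟩
  rw [flipLabelAn, dif_pos h, ← emb_injective h.choose_spec]

theorem flipLabelAn_bot (n : ℕ) (π : Phat (AnP n) → ℝ) : flipLabelAn n π ⊥ = π ⊥ :=
  dif_neg fun ⟨q, h⟩ => emb_ne_bot q h.symm

theorem flipLabelAn_topHat (n : ℕ) (π : Phat (AnP n) → ℝ) :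
    flipLabelAn n π (topHat _) = π (topHat _) :=
  dif_neg fun ⟨q, h⟩ => emb_ne_topHat q h.symm

theorem flipLabelRect_emb (m : ℕ) (σ : Phat (RectP m m) → ℝ) (p : RectP m m) :
    flipLabelRect m σ (emb p) = σ (emb (flipRect m p)) := by
  have h : ∃ q : RectP m m, emb p = emb q := ⟨p, rfl⟩
  rw [flipLabelRect, dif_pos h, ← emb_injective h.choose_spec]

theorem flipLabelRect_bot (m : ℕ) (σ : Phat (RectP m m) → ℝ) : flipLabelRect m σ ⊥ = σ ⊥ :=
  dif_neg fun ⟨q, h⟩ => emb_ne_bot q h.symm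

theorem flipLabelRect_topHat (m : ℕ) (σ : Phat (RectP m m) → ℝ) :
    flipLabelRect m σ (topHat _) = σ (topHat _) :=
  dif_neg fun ⟨q, h⟩ => emb_ne_topHat q h.symm

theorem flipLabelAn_pos {n : ℕ} {π : Phat (AnP n) → ℝ} (hπ : ∀ x, 0 < π x) (x : Phat (AnP n)) :
    0 < flipLabelAn n π x := by
  rw [flipLabelAn]
  split_ifs <;> exact hπ _

theorem flipLabelRect_pos {m : ℕ} {σ : Phat (RectP m m) → ℝ} (hσ : ∀ x, 0 < σ x)
    (x : Phat (RectP m m)) : 0 < flipLabelRect m σ x := by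
  rw [flipLabelRect]
  split_ifs <;> exact hσ _

theorem rectExt_flipLabelRect {m : ℕ} (σ : Phat (RectP m m) → ℝ) (i j : ℕ) :
    rectExt (flipLabelRect m σ) i j = rectExt σ j i := by
  by_cases h : 1 ≤ i ∧ i ≤ m ∧ 1 ≤ j ∧ j ≤ m
  · rw [rectExt_apply _ h, flipLabelRect_emb]
    exact (rectExt_eq σ rfl rfl).symm
  · rw [rectExt_eq_zero _ h, rectExt_eq_zero _ (by omega)]

theorem anExt_flipLabelAn {n : ℕ} (π : Phat (AnP n) → ℝ) {i j : ℕ} (hi : i ≤ n + 1)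
    (hj : j ≤ n + 1) : anExt (flipLabelAn n π) i j = anExt π (n + 1 - j) (n + 1 - i) := by
  by_cases h : 1 ≤ i ∧ i ≤ j ∧ j ≤ n
  · rw [anExt_apply _ h, flipLabelAn_emb]
    exact (anExt_eq π rfl rfl).symm
  · rw [anExt_eq_zero _ h, anExt_eq_zero _ (by omega)]

theorem IsRow.flipLabelRect {m : ℕ} {π σ : Phat (RectP m m) → ℝ} (h : IsRow π σ)
    (hπ : ∀ x, 0 < π x) (hσ : ∀ x, 0 < σ x) :
    IsRow (flipLabelRect m π) (flipLabelRect m σ) := by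
  refine isRow_rect (flipLabelRect_pos hπ) (flipLabelRect_pos hσ) ?_ ?_ fun i j hij => ?_
  · rw [flipLabelRect_bot, flipLabelRect_bot, h.bot]
  · rw [flipLabelRect_topHat, flipLabelRect_topHat, h.top]
  · simp only [rectExt_flipLabelRect, flipLabelRect_bot, flipLabelRect_topHat]
    rw [add_comm (rectExt σ j (i + 1))⁻¹, add_comm (rectExt π j (i - 1)),
      show (if i = m ∧ j = m then (σ (topHat _))⁻¹ else 0) =
        if j = m ∧ i = m then (σ (topHat _))⁻¹ else 0 from if_congr and_comm rfl rfl,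
      show (if i = 1 ∧ j = 1 then π ⊥ else 0) = if j = 1 ∧ i = 1 then π ⊥ else 0
        from if_congr and_comm rfl rfl]
    exact h.rect_eq hπ hσ (by omega)

theorem IsRow.flipLabelAn {n : ℕ} {π σ : Phat (AnP n) → ℝ} (h : IsRow π σ)
    (hπ : ∀ x, 0 < π x) (hσ : ∀ x, 0 < σ x) : IsRow (flipLabelAn n π) (flipLabelAn n σ) := by
  refine isRow_an (flipLabelAn_pos hπ) (flipLabelAn_pos hσ) ?_ ?_ fun i j hij => ?_
  · rw [flipLabelAn_bot, flipLabelAn_bot, h.bot]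
  · rw [flipLabelAn_topHat, flipLabelAn_topHat, h.top]
  · have := h.an_eq hπ hσ (i := n + 1 - j) (j := n + 1 - i) (by omega)
    rw [anExt_flipLabelAn _ (by omega) (by omega), anExt_flipLabelAn _ (by omega) (by omega),
      anExt_flipLabelAn _ (by omega) (by omega), anExt_flipLabelAn _ (by omega) (by omega),
      anExt_flipLabelAn _ (by omega) (by omega), anExt_flipLabelAn _ (by omega) (by omega),
      flipLabelAn_bot, flipLabelAn_topHat, add_comm (anExt σ (n + 1 - j) (n + 1 - (i - 1)))⁻¹,
      add_comm (anExt π (n + 1 - j) (n + 1 - (i + 1))),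
      show n + 1 - (i - 1) = n + 1 - i + 1 by omega, show n + 1 - (i + 1) = n + 1 - i - 1 by omega,
      show n + 1 - (j - 1) = n + 1 - j + 1 by omega, show n + 1 - (j + 1) = n + 1 - j - 1 by omega]
    convert this using 3
    · exact if_congr (by omega) rfl rfl
    · omega

theorem RowB_iterate_flipLabelRect {m : ℕ} {π : Phat (RectP m m) → ℝ} (hπ : ∀ x, 0 < π x)
    (ℓ : ℕ) : (RowB (rkRect m m) (m + m - 2))^[ℓ] (flipLabelRect m π) =
      flipLabelRect m ((RowB (rkRect m m) (m + m - 2))^[ℓ] π) := by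
  induction ℓ with
  | zero => rfl
  | succ ℓ ih =>
    rw [Function.iterate_succ_apply', Function.iterate_succ_apply', ih]
    have h := isRow_RowB rkRect_covBy rkRect_le ((RowB (rkRect m m) (m + m - 2))^[ℓ] π)
    exact (h.flipLabelRect (RowB_iterate_pos hπ ℓ) (RowB_pos (RowB_iterate_pos hπ ℓ))).eq_RowB
      rkRect_covBy rkRect_le

theorem RowB_iterate_flipLabelAn {n : ℕ} {π : Phat (AnP n) → ℝ} (hπ : ∀ x, 0 < π x)
    (ℓ : ℕ) : (RowB (rkAn n) (n - 1))^[ℓ] (flipLabelAn n π) =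
      flipLabelAn n ((RowB (rkAn n) (n - 1))^[ℓ] π) := by
  induction ℓ with
  | zero => rfl
  | succ ℓ ih =>
    rw [Function.iterate_succ_apply', Function.iterate_succ_apply', ih]
    have h := isRow_RowB rkAn_covBy rkAn_le ((RowB (rkAn n) (n - 1))^[ℓ] π)
    exact (h.flipLabelAn (RowB_iterate_pos hπ ℓ) (RowB_pos (RowB_iterate_pos hπ ℓ))).eq_RowB
      rkAn_covBy rkAn_le

end Flip

section Embedding

variable {n : ℕ} {κ : ℝ}

theorem iotaAn_bot (π : Phat (AnP n) → ℝ) : iotaAn n κ π ⊥ = 1 := if_pos rfl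

theorem iotaAn_topHat (π : Phat (AnP n) → ℝ) : iotaAn n κ π (topHat _) = 4 * κ ^ 2 := by
  rw [iotaAn, if_neg topHat_ne_bot, if_pos rfl]

theorem iotaAn_emb (π : Phat (AnP n) → ℝ) (v : RectP (n + 1) (n + 1)) :
    iotaAn n κ π (emb v) = iotaVal n κ π v := by
  have h : ∃ q : RectP (n + 1) (n + 1), emb v = emb q := ⟨v, rfl⟩
  rw [iotaAn, if_neg (emb_ne_bot v), if_neg (emb_ne_topHat v), dif_pos h,
    ← emb_injective h.choose_spec]

theorem rectExt_iotaAn_upper (π : Phat (AnP n) → ℝ) {i j : ℕ} (h : n + 2 < i + j) :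
    rectExt (iotaAn n κ π) i j = 4 * κ * anExt π (n + 2 - i) (j - 1) := by
  by_cases hij : 1 ≤ i ∧ i ≤ n + 1 ∧ 1 ≤ j ∧ j ≤ n + 1
  · rw [rectExt_apply _ hij, iotaAn_emb, iotaVal, dif_pos (by exact h),
      anExt_apply π (by omega)]
    rfl
  · rw [rectExt_eq_zero _ hij, anExt_eq_zero _ (by omega), mul_zero]

theorem rectExt_iotaAn_middle (π : Phat (AnP n) → ℝ) {i j : ℕ} (hi : 1 ≤ i) (hj : 1 ≤ j)
    (h : i + j = n + 2) : rectExt (iotaAn n κ π) i j = 2 * κ := by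
  rw [rectExt_apply _ (by omega), iotaAn_emb, iotaVal, dif_neg (by rw [rectMk_val]; omega),
    dif_pos (by exact h)]

theorem rectExt_iotaAn_lower (π : Phat (AnP n) → ℝ) {i j e : ℕ} (h : i + j + e = n + 2)
    (he : 1 ≤ e) : rectExt (iotaAn n κ π) i j =
      κ * (anExt ((RowB (rkAn n) (n - 1))^[e] π) j (n + 1 - i))⁻¹ := by
  by_cases hij : 1 ≤ i ∧ 1 ≤ j
  · have hji : 1 ≤ j ∧ j ≤ n + 1 - i ∧ n + 1 - i ≤ n := by omega
    have hrk : rkAn n (anMk j (n + 1 - i) hji) + 1 = e := by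
      rw [rkAn, anMk_val]
      omega
    have hrvac := RvacB_emb rkAn_covBy rkAn_le π (anMk j (n + 1 - i) hji)
    rw [hrk] at hrvac
    rw [rectExt_apply _ (by omega), iotaAn_emb, iotaVal, dif_neg (by rw [rectMk_val]; omega),
      dif_neg (by rw [rectMk_val]; omega), anExt_apply _ hji, ← hrvac, ← div_eq_mul_inv]
    rfl
  · rw [rectExt_eq_zero _ (by omega), anExt_eq_zero _ (by omega), inv_zero, mul_zero]

theorem iotaAn_pos (hκ : 0 < κ) {π : Phat (AnP n) → ℝ} (hπ : ∀ x, 0 < π x)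
    (x : Phat (RectP (n + 1) (n + 1))) : 0 < iotaAn n κ π x := by
  rcases phat_cases x with rfl | rfl | ⟨v, rfl⟩
  · rw [iotaAn_bot]
    exact one_pos
  · rw [iotaAn_topHat]
    positivity
  · have hv := v.2
    rw [← rectExt_eq (iotaAn n κ π) (u := v) rfl rfl]
    rcases lt_trichotomy (n + 2) (v.val.1 + v.val.2) with h | h | h
    · rw [rectExt_iotaAn_upper _ h]
      have := anExt_pos hπ (i := n + 2 - v.val.1) (j := v.val.2 - 1) (by omega)
      positivity
    · rw [rectExt_iotaAn_middle _ (by omega) (by omega) h.symm]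
      positivity
    · rw [rectExt_iotaAn_lower _ (Nat.add_sub_of_le h.le) (by omega)]
      have := anExt_pos (RowB_iterate_pos (rk := rkAn n) (r := n - 1) hπ
        (n + 2 - (v.val.1 + v.val.2))) (i := v.val.2) (j := n + 1 - v.val.1) (by omega)
      positivity

theorem rect_labeling_ext {p q : ℕ} {σ τ : Phat (RectP p q) → ℝ} (hbot : σ ⊥ = τ ⊥)
    (htop : σ (topHat _) = τ (topHat _))
    (h : ∀ i j, 1 ≤ i ∧ i ≤ p ∧ 1 ≤ j ∧ j ≤ q → rectExt σ i j = rectExt τ i j) : σ = τ :=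
  phat_ext hbot htop fun v => by
    rw [← rectExt_eq σ (u := v) rfl rfl, ← rectExt_eq τ (u := v) rfl rfl, h _ _ v.2]

theorem an_labeling_ext {π τ : Phat (AnP n) → ℝ} (hbot : π ⊥ = τ ⊥)
    (htop : π (topHat _) = τ (topHat _))
    (h : ∀ i j, 1 ≤ i ∧ i ≤ j ∧ j ≤ n → anExt π i j = anExt τ i j) : π = τ :=
  phat_ext hbot htop fun v => by
    rw [← anExt_eq π (u := v) rfl rfl, ← anExt_eq τ (u := v) rfl rfl, h _ _ v.2]

theorem flipLabelRect_iotaAn {π : Phat (AnP n) → ℝ} (hπ : ∀ x, 0 < π x) :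
    flipLabelRect (n + 1) (iotaAn n κ π) = iotaAn n κ (flipLabelAn n π) := by
  refine rect_labeling_ext ?_ ?_ fun i j hij => ?_
  · rw [flipLabelRect_bot, iotaAn_bot, iotaAn_bot]
  · rw [flipLabelRect_topHat, iotaAn_topHat, iotaAn_topHat]
  · rw [rectExt_flipLabelRect]
    rcases lt_trichotomy (n + 2) (i + j) with h | h | h
    · rw [rectExt_iotaAn_upper _ h, rectExt_iotaAn_upper _ (by omega),
        anExt_flipLabelAn _ (by omega) (by omega), show n + 1 - (n + 2 - i) = i - 1 by omega,
        show n + 1 - (j - 1) = n + 2 - j by omega]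
    · rw [rectExt_iotaAn_middle _ (by omega) (by omega) h.symm,
        rectExt_iotaAn_middle _ (by omega) (by omega) (by omega)]
    · rw [rectExt_iotaAn_lower _ (Nat.add_sub_of_le h.le) (by omega),
        rectExt_iotaAn_lower _ (e := n + 2 - (i + j)) (by omega) (by omega),
        RowB_iterate_flipLabelAn hπ, anExt_flipLabelAn _ (by omega) (by omega),
        show n + 1 - (n + 1 - i) = i by omega]

theorem RowB_iotaAn (hn : 1 ≤ n) (hκ : 0 < κ) {π : Phat (AnP n) → ℝ} (hπ : ∀ x, 0 < π x)
    (hbot : π ⊥ = 1) (htop : π (topHat _) = κ) :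
    RowB (rkRect (n + 1) (n + 1)) (n + 1 + (n + 1) - 2) (iotaAn n κ π) =
      iotaAn n κ (RowB (rkAn n) (n - 1) π) := by
  have hs (ℓ : ℕ) := RowB_iterate_pos (rk := rkAn n) (r := n - 1) hπ ℓ
  have hrow (ℓ : ℕ) : IsRow ((RowB (rkAn n) (n - 1))^[ℓ] π)
      ((RowB (rkAn n) (n - 1))^[ℓ + 1] π) := by
    rw [Function.iterate_succ_apply']
    exact isRow_RowB rkAn_covBy rkAn_le _
  refine IsRow.eq_RowB rkRect_covBy rkRect_le (isRow_rect (iotaAn_pos hκ hπ)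
    (iotaAn_pos hκ (RowB_pos hπ)) (by rw [iotaAn_bot, iotaAn_bot])
    (by rw [iotaAn_topHat, iotaAn_topHat]) fun i j hij => ?_)
  rcases lt_trichotomy (n + 2) (i + j) with h | h | h
  · have key := (hrow 0).an_eq (hs 0) (hs 1) (i := n + 2 - i) (j := j - 1) (by omega)
    rw [rectExt_iotaAn_upper _ h, rectExt_iotaAn_upper _ h,
      rectExt_iotaAn_upper _ (i := i + 1) (by omega),
      rectExt_iotaAn_upper _ (j := j + 1) (by omega), iotaAn_topHat]
    rw [RowB_iterate_topHat, htop, RowB_iterate_bot, hbot] at key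
    rw [show n + 2 - (i + 1) = n + 2 - i - 1 by omega, show j + 1 - 1 = j - 1 + 1 by omega]
    have hE : (if i = n + 1 ∧ j = n + 1 then (4 * κ ^ 2)⁻¹ else 0) =
        (4 * κ)⁻¹ * if n + 2 - i = 1 ∧ j - 1 = n then κ⁻¹ else 0 := by
      rw [mul_ite, mul_zero, ← mul_inv]
      exact if_congr (by omega) (by ring) rfl
    have hB : rectExt (iotaAn n κ π) (i - 1) j + rectExt (iotaAn n κ π) i (j - 1) +
        (if i = 1 ∧ j = 1 then iotaAn n κ π ⊥ else 0) =
        4 * κ * (anExt π (n + 2 - i + 1) (j - 1) + anExt π (n + 2 - i) (j - 1 - 1) +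
          if n + 2 - i = j - 1 then 1 else 0) := by
      rw [if_neg (by omega), add_zero]
      by_cases hd : n + 2 - i = j - 1
      · rw [rectExt_iotaAn_middle _ (by omega) (by omega) (by omega),
          rectExt_iotaAn_middle _ (by omega) (by omega) (by omega), if_pos hd,
          anExt_eq_zero _ (by omega), anExt_eq_zero _ (by omega)]
        ring
      · rw [rectExt_iotaAn_upper _ (by omega), rectExt_iotaAn_upper _ (by omega), if_neg hd,
          show n + 2 - (i - 1) = n + 2 - i + 1 by omega]
        ring
    rw [zero_add, Function.iterate_one, Function.iterate_zero, id] at key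
    rw [hE, hB, mul_inv (4 * κ), mul_inv (4 * κ), ← mul_add, ← mul_add, ← key]
    field_simp
  · rw [rectExt_iotaAn_middle _ (by omega) (by omega) h.symm,
      rectExt_iotaAn_middle _ (by omega) (by omega) h.symm,
      rectExt_iotaAn_upper _ (i := i + 1) (by omega),
      rectExt_iotaAn_upper _ (j := j + 1) (by omega), if_neg (by omega), if_neg (by omega),
      rectExt_iotaAn_lower _ (i := i - 1) (e := 1) (by omega) le_rfl,
      rectExt_iotaAn_lower _ (j := j - 1) (e := 1) (by omega) le_rfl,
      show n + 2 - (i + 1) = j - 1 by omega, show n + 2 - i = j by omega,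
      show n + 1 - (i - 1) = j by omega, show n + 1 - i = j - 1 by omega, Nat.add_sub_cancel,
      Function.iterate_one]
    rw [mul_inv, mul_inv]
    field_simp
    ring
  · obtain ⟨e, he⟩ := Nat.exists_eq_add_of_lt h
    have hs₁ := anExt_pos (hs (e + 1)) (i := j) (j := n + 1 - i) (by omega)
    have hs₂ := anExt_pos (hs (e + 2)) (i := j) (j := n + 1 - i) (by omega)
    have key := (hrow (e + 1)).an_eq (hs _) (hs _) (i := j) (j := n + 1 - i) (by omega)
    rw [RowB_iterate_topHat, htop, RowB_iterate_bot, hbot] at key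
    have hX {i j e : ℕ} (h : i + j + e = n + 2) (he : 1 ≤ e) :
        rectExt (iotaAn n κ (RowB (rkAn n) (n - 1) π)) i j =
          κ * (anExt ((RowB (rkAn n) (n - 1))^[e + 1] π) j (n + 1 - i))⁻¹ := by
      rw [rectExt_iotaAn_lower _ h he, ← Function.iterate_succ_apply]
    have hA : (rectExt (iotaAn n κ (RowB (rkAn n) (n - 1) π)) (i + 1) j)⁻¹ +
        (rectExt (iotaAn n κ (RowB (rkAn n) (n - 1) π)) i (j + 1))⁻¹ +
        (if i = n + 1 ∧ j = n + 1 then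
          (iotaAn n κ (RowB (rkAn n) (n - 1) π) (topHat _))⁻¹ else 0) =
        κ⁻¹ * (anExt ((RowB (rkAn n) (n - 1))^[e + 1] π) (j + 1) (n + 1 - i) +
          anExt ((RowB (rkAn n) (n - 1))^[e + 1] π) j (n + 1 - i - 1) +
          if j = n + 1 - i then 1 else 0) := by
      rw [if_neg (c := i = n + 1 ∧ j = n + 1) (by omega), add_zero]
      by_cases hd : j = n + 1 - i
      · rw [rectExt_iotaAn_middle _ (by omega) (by omega) (by omega),
          rectExt_iotaAn_middle _ (by omega) (by omega) (by omega), if_pos hd,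
          anExt_eq_zero _ (by omega), anExt_eq_zero _ (by omega)]
        field_simp
        norm_num
      · rw [hX (e := e) (by omega) (by omega), hX (e := e) (by omega) (by omega), if_neg hd,
          mul_inv, mul_inv, inv_inv, inv_inv, show n + 1 - (i + 1) = n + 1 - i - 1 by omega]
        ring
    have hE : (if i = 1 ∧ j = 1 then iotaAn n κ π ⊥ else 0) =
        κ * if j = 1 ∧ n + 1 - i = n then κ⁻¹ else 0 := by
      rw [mul_ite, mul_zero, iotaAn_bot, mul_inv_cancel₀ hκ.ne']
      exact if_congr (by omega) rfl rfl
    rw [hA, ← key, hE, hX (e := e + 1) (by omega) (by omega),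
      rectExt_iotaAn_lower π (e := e + 1) (by omega) (by omega),
      rectExt_iotaAn_lower π (i := i - 1) (e := e + 2) (by omega) (by omega),
      rectExt_iotaAn_lower π (j := j - 1) (e := e + 2) (by omega) (by omega),
      show n + 1 - (i - 1) = n + 1 - i + 1 by omega]
    rw [show e + 1 + 1 = e + 2 by omega]
    field_simp
    ring

theorem RowB_iterate_iotaAn (hn : 1 ≤ n) (hκ : 0 < κ) {π : Phat (AnP n) → ℝ}
    (hπ : ∀ x, 0 < π x) (hbot : π ⊥ = 1) (htop : π (topHat _) = κ) (ℓ : ℕ) :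
    (RowB (rkRect (n + 1) (n + 1)) (n + 1 + (n + 1) - 2))^[ℓ] (iotaAn n κ π) =
      iotaAn n κ ((RowB (rkAn n) (n - 1))^[ℓ] π) := by
  induction ℓ with
  | zero => rfl
  | succ ℓ ih =>
    rw [Function.iterate_succ_apply', Function.iterate_succ_apply', ih,
      RowB_iotaAn hn hκ (RowB_iterate_pos hπ ℓ) (by rw [RowB_iterate_bot, hbot])
        (by rw [RowB_iterate_topHat, htop])]

/-- Reciprocity for the iterates of birational rowmotion on the rectangle. -/
theorem rectExt_RowB_iterate {p q : ℕ} {σ : Phat (RectP p q) → ℝ} (hσ : ∀ x, 0 < σ x)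
    {i j : ℕ} (hi : i ≤ p + 1) (hj : j ≤ q) {ℓ N : ℕ} (hN : N + 1 = ℓ + i + j) :
    rectExt ((RowB (rkRect p q) (p + q - 2))^[N] σ) i j = σ ⊥ * σ (topHat _) *
      (rectExt ((RowB (rkRect p q) (p + q - 2))^[ℓ] σ) (p + 1 - i) (q + 1 - j))⁻¹ := by
  refine reciprocity_rectExt (s := fun ℓ => (RowB (rkRect p q) (p + q - 2))^[ℓ] σ)
    (RowB_iterate_pos hσ) (fun ℓ => ?_) (fun ℓ => RowB_iterate_bot ℓ σ)
    (fun ℓ => RowB_iterate_topHat ℓ σ) j hj i hi ℓ N hN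
  rw [Function.iterate_succ_apply']
  exact isRow_RowB rkRect_covBy rkRect_le _

/-- The `(n+1)`-st power of birational rowmotion on `Aⁿ` is `Flip`. -/
theorem RowB_iterate_an (hn : 1 ≤ n) (hκ : 0 < κ) {π : Phat (AnP n) → ℝ} (hπ : ∀ x, 0 < π x)
    (hbot : π ⊥ = 1) (htop : π (topHat _) = κ) :
    (RowB (rkAn n) (n - 1))^[n + 1] π = flipLabelAn n π := by
  refine an_labeling_ext ?_ ?_ fun i j hij => ?_
  · rw [RowB_iterate_bot, flipLabelAn_bot]
  · rw [RowB_iterate_topHat, flipLabelAn_topHat]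
  · have key := rectExt_RowB_iterate (iotaAn_pos hκ hπ) (i := n + 1 - j) (j := i) (ℓ := 0)
      (N := n - (j - i)) (by omega) (by omega) (by omega)
    rw [RowB_iterate_iotaAn hn hκ hπ hbot htop, Function.iterate_zero, id, iotaAn_bot,
      iotaAn_topHat, rectExt_iotaAn_lower _ (e := j - i + 1) (by omega) (by omega),
      ← Function.iterate_add_apply, show j - i + 1 + (n - (j - i)) = n + 1 by omega,
      show n + 1 - (n + 1 - j) = j by omega, rectExt_iotaAn_upper _ (by omega),
      show n + 2 - (n + 1 + 1 - (n + 1 - j)) = n + 1 - j by omega,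
      show n + 1 + 1 - i - 1 = n + 1 - i by omega] at key
    rw [anExt_flipLabelAn _ (by omega) (by omega)]
    have h₁ := anExt_pos (RowB_iterate_pos (rk := rkAn n) (r := n - 1) hπ (n + 1)) hij
    have h₂ := anExt_pos hπ (i := n + 1 - j) (j := n + 1 - i) (by omega)
    field_simp at key
    linarith

/-- The labeling of `Aⁿ` read off from the upper half of a labeling of the square. -/
noncomputable def upperHalf (n : ℕ) (κ : ℝ) (σ : Phat (RectP (n + 1) (n + 1)) → ℝ) :
    Phat (AnP n) → ℝ :=
  WithBot.recBotCoe 1 (WithTop.recTopCoe κ fun v =>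
    rectExt σ (n + 2 - v.val.1) (v.val.2 + 1) / (4 * κ))

theorem upperHalf_emb (σ : Phat (RectP (n + 1) (n + 1)) → ℝ) (v : AnP n) :
    upperHalf n κ σ (emb v) = rectExt σ (n + 2 - v.val.1) (v.val.2 + 1) / (4 * κ) := rfl

theorem upperHalf_pos (hκ : 0 < κ) {σ : Phat (RectP (n + 1) (n + 1)) → ℝ} (hσ : ∀ x, 0 < σ x)
    (x : Phat (AnP n)) : 0 < upperHalf n κ σ x := by
  rcases phat_cases x with rfl | rfl | ⟨v, rfl⟩
  · exact one_pos
  · exact hκ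
  · have hv := v.2
    rw [upperHalf_emb]
    have := rectExt_pos hσ (i := n + 2 - v.val.1) (j := v.val.2 + 1) (by omega)
    positivity

theorem anExt_upperHalf (σ : Phat (RectP (n + 1) (n + 1)) → ℝ) {i j : ℕ} (h : i ≤ j) :
    anExt (upperHalf n κ σ) i j = rectExt σ (n + 2 - i) (j + 1) / (4 * κ) := by
  by_cases hij : 1 ≤ i ∧ i ≤ j ∧ j ≤ n
  · rw [anExt_apply _ hij, upperHalf_emb]
    rfl
  · rw [anExt_eq_zero _ hij, rectExt_eq_zero _ (by omega), zero_div]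

theorem isRow_upperHalf (hκ : 0 < κ) {σ τ : Phat (RectP (n + 1) (n + 1)) → ℝ} (h : IsRow σ τ)
    (hσ : ∀ x, 0 < σ x) (hτ : ∀ x, 0 < τ x) (htop : τ (topHat _) = 4 * κ ^ 2)
    (hmid : ∀ i j, 1 ≤ i → 1 ≤ j → i + j = n + 2 → rectExt σ i j = 2 * κ) :
    IsRow (upperHalf n κ σ) (upperHalf n κ τ) := by
  refine isRow_an (upperHalf_pos hκ hσ) (upperHalf_pos hκ hτ) rfl rfl fun i j hij => ?_
  have key := h.rect_eq hσ hτ (i := n + 2 - i) (j := j + 1) (by omega)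
  rw [anExt_upperHalf _ (by omega), anExt_upperHalf _ (by omega), anExt_upperHalf _ (by omega),
    anExt_upperHalf _ (by omega), show n + 2 - (i - 1) = n + 2 - i + 1 by omega]
  have hB : anExt (upperHalf n κ σ) (i + 1) j + anExt (upperHalf n κ σ) i (j - 1) +
      (if i = j then upperHalf n κ σ ⊥ else 0) = (4 * κ)⁻¹ *
        (rectExt σ (n + 2 - i - 1) (j + 1) + rectExt σ (n + 2 - i) (j + 1 - 1) +
          if n + 2 - i = 1 ∧ j + 1 = 1 then σ ⊥ else 0) := by
    rw [if_neg (c := n + 2 - i = 1 ∧ j + 1 = 1) (by omega), add_zero]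
    by_cases hd : i = j
    · rw [if_pos hd, anExt_eq_zero _ (by omega), anExt_eq_zero _ (by omega),
        hmid _ _ (by omega) (by omega) (by omega), hmid _ _ (by omega) (by omega) (by omega)]
      have : upperHalf n κ σ ⊥ = 1 := rfl
      rw [this]
      field_simp
      norm_num
    · rw [if_neg hd, anExt_upperHalf _ (by omega), anExt_upperHalf _ (by omega),
        show n + 2 - (i + 1) = n + 2 - i - 1 by omega, show j - 1 + 1 = j + 1 - 1 by omega]
      ring
  have hE : (if i = 1 ∧ j = n then (upperHalf n κ τ (topHat _))⁻¹ else 0) =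
      4 * κ * if n + 2 - i = n + 1 ∧ j + 1 = n + 1 then (τ (topHat _))⁻¹ else 0 := by
    have : upperHalf n κ τ (topHat _) = κ := rfl
    rw [mul_ite, mul_zero, htop, this]
    exact if_congr (by omega) (by field_simp) rfl
  rw [hB, ← key, hE, inv_div, inv_div]
  field_simp

/-- A labeling of the square on which the `(n+1)`-st power of rowmotion is `Flip` is in the image
of the embedding. -/
theorem iotaAn_upperHalf (hκ : 0 < κ) {σ : Phat (RectP (n + 1) (n + 1)) → ℝ}
    (hσ : ∀ x, 0 < σ x) (hbot : σ ⊥ = 1) (htop : σ (topHat _) = 4 * κ ^ 2)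
    (hflip : (RowB (rkRect (n + 1) (n + 1)) (n + 1 + (n + 1) - 2))^[n + 1] σ =
      flipLabelRect (n + 1) σ) : iotaAn n κ (upperHalf n κ σ) = σ := by
  set ρ := RowB (rkRect (n + 1) (n + 1)) (n + 1 + (n + 1) - 2) with hρ
  have hs (ℓ : ℕ) : ∀ x, 0 < ρ^[ℓ] σ x := RowB_iterate_pos hσ ℓ
  have hflip' (ℓ : ℕ) : ρ^[n + 1] (ρ^[ℓ] σ) = flipLabelRect (n + 1) (ρ^[ℓ] σ) := by
    rw [← Function.iterate_add_apply, add_comm (n + 1) ℓ, Function.iterate_add_apply, hflip,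
      RowB_iterate_flipLabelRect hσ]
  have hrec (ℓ : ℕ) {i j e : ℕ} (h : i + j + e = n + 2) (hi : 1 ≤ i) (hj : 1 ≤ j) :
      rectExt (ρ^[ℓ] σ) j i =
        4 * κ ^ 2 * (rectExt (ρ^[e] (ρ^[ℓ] σ)) (n + 1 + 1 - i) (n + 1 + 1 - j))⁻¹ := by
    have := rectExt_RowB_iterate (hs ℓ) (i := i) (j := j) (ℓ := e) (N := n + 1) (by omega)
      (by omega) (by omega)
    rwa [← hρ, hflip', rectExt_flipLabelRect, RowB_iterate_bot, RowB_iterate_topHat, hbot, htop,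
      one_mul] at this
  have hmid (ℓ : ℕ) (i j : ℕ) (hi : 1 ≤ i) (hj : 1 ≤ j) (h : i + j = n + 2) :
      rectExt (ρ^[ℓ] σ) i j = 2 * κ := by
    have h₁ := hrec ℓ (i := j) (j := i) (e := 0) (by omega) hj hi
    have h₂ := rectExt_pos (hs ℓ) (i := i) (j := j) (by omega)
    rw [Function.iterate_zero, id, show n + 1 + 1 - j = i by omega,
      show n + 1 + 1 - i = j by omega, eq_mul_inv_iff_mul_eq₀ h₂.ne'] at h₁
    nlinarith
  have hres (ℓ : ℕ) :
      (RowB (rkAn n) (n - 1))^[ℓ] (upperHalf n κ σ) = upperHalf n κ (ρ^[ℓ] σ) := by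
    induction ℓ with
    | zero => rfl
    | succ ℓ ih =>
      rw [Function.iterate_succ_apply', ih]
      refine (isRow_upperHalf hκ ?_ (hs ℓ) (hs (ℓ + 1)) ?_ (hmid ℓ)).eq_RowB rkAn_covBy rkAn_le
      · rw [Function.iterate_succ_apply']
        exact isRow_RowB rkRect_covBy rkRect_le _
      · rw [RowB_iterate_topHat, htop]
  refine rect_labeling_ext ?_ ?_ fun i j hij => ?_
  · rw [iotaAn_bot, hbot]
  · rw [iotaAn_topHat, htop]
  · rcases lt_trichotomy (n + 2) (i + j) with h | h | h
    · rw [rectExt_iotaAn_upper _ h, anExt_upperHalf _ (by omega),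
        show n + 2 - (n + 2 - i) = i by omega, show j - 1 + 1 = j by omega]
      field_simp
    · rw [rectExt_iotaAn_middle _ (by omega) (by omega) h.symm]
      exact (hmid 0 i j (by omega) (by omega) h.symm).symm
    · have key := hrec 0 (i := j) (j := i) (e := n + 2 - (i + j)) (by omega) (by omega) (by omega)
      rw [Function.iterate_zero, id] at key
      rw [rectExt_iotaAn_lower _ (Nat.add_sub_of_le h.le) (by omega), hres,
        anExt_upperHalf _ (by omega), key, inv_div, show n + 1 - i + 1 = n + 1 + 1 - i by omega]
      field_simp

end Embedding

/-- For every `n ≥ 1` and `κ > 0`, the embedding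
`ι^B_A : F^B_κ(Aⁿ) → F^B_{4κ²}(rect(n+1,n+1))` satisfies:
(i) `Flip ∘ ι^B_A = ι^B_A ∘ Flip` and `Row^B_F ∘ ι^B_A = ι^B_A ∘ Row^B_F`;
(ii) the image of `ι^B_A` equals
`{π ∈ F^B_{4κ²}(rect(n+1,n+1)) : (Row^B_F)^(n+1)(π) = Flip(π)}`. -/
theorem stmt11 (n : ℕ) (hn : 1 ≤ n) (κ : ℝ) (hκ : 0 < κ) :
    (∀ π : Phat (AnP n) → ℝ, (∀ x, 0 < π x) → π ⊥ = 1 → π (topHat (AnP n)) = κ →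
      flipLabelRect (n + 1) (iotaAn n κ π) = iotaAn n κ (flipLabelAn n π) ∧
      RowB (rkRect (n + 1) (n + 1)) (2 * n) (iotaAn n κ π)
        = iotaAn n κ (RowB (rkAn n) (n - 1) π)) ∧
    (∀ σ : Phat (RectP (n + 1) (n + 1)) → ℝ,
      (∀ x, 0 < σ x) → σ ⊥ = 1 → σ (topHat (RectP (n + 1) (n + 1))) = 4 * κ ^ 2 →
      ((∃ π : Phat (AnP n) → ℝ,
          (∀ x, 0 < π x) ∧ π ⊥ = 1 ∧ π (topHat (AnP n)) = κ ∧ iotaAn n κ π = σ) ↔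
        (RowB (rkRect (n + 1) (n + 1)) (2 * n))^[n + 1] σ = flipLabelRect (n + 1) σ)) := by
  rw [show 2 * n = n + 1 + (n + 1) - 2 by omega]
  refine ⟨fun π hπ hbot htop => ⟨flipLabelRect_iotaAn hπ, RowB_iotaAn hn hκ hπ hbot htop⟩,
    fun σ hσ hbot htop => ⟨?_, fun h => ?_⟩⟩
  · rintro ⟨π, hπ, hbot', htop', rfl⟩
    rw [RowB_iterate_iotaAn hn hκ hπ hbot' htop', RowB_iterate_an hn hκ hπ hbot' htop',
      flipLabelRect_iotaAn hπ]
  · exact ⟨upperHalf n κ σ, upperHalf_pos hκ hσ, rfl, rfl, iotaAn_upperHalf hκ hσ hbot htop h⟩
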